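/- Let G = (V,E) be a cycle hypergraph. Then the multilinear polytope is exactly the set of points of P_FR(G) satisfying all simple odd β-cycle inequalities: P_ML(G) = { z ∈ P_FR(G) : ℓ_{(C,σ)}(z) ≥ 1 for every odd signed closed walk (C,σ) in G }. -/

import Mathlib

open Finset

namespace BPO

variable {V E : Type} [DecidableEq V]

/-- Building block `s^inc_{e,v}(z) = z_v - z_e`. -/
def sInc (e : E) (v : V) (z : V ⊕ E → ℝ) : ℝ := z (Sum.inl v) - z (Sum.inr e)

/-- Building block `s^odd_{e,U,W}(z)`. -/
def sOdd (G : E → Finset V) (e : E) (U W : Finset V) (z : V ⊕ E → ℝ) : ℝ :=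
  2 * z (Sum.inr e) - 1 + ∑ u ∈ U, (1 - z (Sum.inl u)) + ∑ w ∈ W, (1 - z (Sum.inl w))
    + ∑ v ∈ G e \ (U ∪ W), (2 - 2 * z (Sum.inl v))

/-- Building block `s^one_{e,U,f}(z)`. -/
def sOne (G : E → Finset V) (e : E) (U : Finset V) (f : E) (z : V ⊕ E → ℝ) : ℝ :=
  2 * z (Sum.inr e) - 1 + ∑ u ∈ U, (1 - z (Sum.inl u)) + (1 - z (Sum.inr f))
    + ∑ v ∈ G e \ (U ∪ G f), (2 - 2 * z (Sum.inl v))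

/-- Building block `s^two_{e,f,g}(z)`. -/
def sTwo (G : E → Finset V) (e f g : E) (z : V ⊕ E → ℝ) : ℝ :=
  2 * z (Sum.inr e) - 1 + (1 - z (Sum.inr f)) + (1 - z (Sum.inr g))
    + ∑ v ∈ G e \ (G f ∪ G g), (2 - 2 * z (Sum.inl v))

/-- Membership in the standard relaxation `P_SR(G)`. -/
def memSR (G : E → Finset V) (z : V ⊕ E → ℝ) : Prop :=
  (∀ x, 0 ≤ z x ∧ z x ≤ 1) ∧
  (∀ e : E, ∀ v ∈ G e, z (Sum.inl v) - z (Sum.inr e) ≥ 0) ∧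
  (∀ e : E, (z (Sum.inr e) - 1) + ∑ v ∈ G e, (1 - z (Sum.inl v)) ≥ 0)

/-- Membership in the flower relaxation `P_FR(G)`: standard relaxation plus all
flower inequalities with at most two neighbors. -/
def memFR (G : E → Finset V) (z : V ⊕ E → ℝ) : Prop :=
  memSR G z ∧
  (∀ f e : E, f ≠ e → (G f ∩ G e).Nonempty →
    (z (Sum.inr f) - 1) + (1 - z (Sum.inr e)) + ∑ v ∈ G f \ G e, (1 - z (Sum.inl v)) ≥ 0) ∧
  (∀ f e₁ e₂ : E, f ≠ e₁ → f ≠ e₂ → e₁ ≠ e₂ →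
    (G f ∩ G e₁).Nonempty → (G f ∩ G e₂).Nonempty → G f ∩ G e₁ ∩ G e₂ = ∅ →
    (z (Sum.inr f) - 1) + (1 - z (Sum.inr e₁)) + (1 - z (Sum.inr e₂))
      + ∑ v ∈ G f \ (G e₁ ∪ G e₂), (1 - z (Sum.inl v)) ≥ 0)

/-- The multilinear polytope `P_ML(G)`. -/
def PML (G : E → Finset V) : Set (V ⊕ E → ℝ) :=
  convexHull ℝ { z | (∀ x, z x = 0 ∨ z x = 1) ∧
    ∀ e : E, z (Sum.inr e) = ∏ v ∈ G e, z (Sum.inl v) }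

/-- A closed walk of length `k ≥ 3`, with nodes `ve i ∈ G (ed (i-1)) ∩ G (ed i)`
and consecutive triple intersections empty (indices cyclic via `ZMod k`). -/
def IsClosedWalk (G : E → Finset V) (k : ℕ) (ve : ZMod k → V) (ed : ZMod k → E) : Prop :=
  3 ≤ k ∧ (∀ i, ve i ∈ G (ed (i - 1)) ∩ G (ed i)) ∧
    ∀ i, G (ed (i - 1)) ∩ G (ed i) ∩ G (ed (i + 1)) = ∅

/-- A signature (`true` = `+`, `false` = `-`) is odd if it has an odd number of `-` signs. -/
def OddSig (k : ℕ) [NeZero k] (sg : ZMod k → Bool) : Prop :=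
  Odd (Finset.univ.filter fun i : ZMod k => sg i = false).card

/-- The length function `ℓ_{(C,σ)}(z)` of a signed closed walk. -/
def lenFun (G : E → Finset V) (k : ℕ) [NeZero k] (ve : ZMod k → V) (ed : ZMod k → E)
    (sg : ZMod k → Bool) (z : V ⊕ E → ℝ) : ℝ :=
  (∑ i ∈ Finset.univ.filter
      (fun i : ZMod k => sg (i - 1) = true ∧ sg i = true ∧ sg (i + 1) = true),
      (sInc (ed i) (ve i) z + sInc (ed i) (ve (i + 1)) z))
  + (∑ i ∈ Finset.univ.filter
      (fun i : ZMod k => sg (i - 1) = false ∧ sg i = false ∧ sg (i + 1) = false),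
      sOdd G (ed i) (G (ed i) ∩ G (ed (i - 1))) (G (ed i) ∩ G (ed (i + 1))) z)
  + (∑ i ∈ Finset.univ.filter
      (fun i : ZMod k => sg (i - 1) = true ∧ sg i = true ∧ sg (i + 1) = false),
      sInc (ed i) (ve i) z)
  + (∑ i ∈ Finset.univ.filter
      (fun i : ZMod k => sg (i - 1) = false ∧ sg i = false ∧ sg (i + 1) = true),
      sOne G (ed i) (G (ed i) ∩ G (ed (i - 1))) (ed (i + 1)) z)
  + (∑ i ∈ Finset.univ.filter
      (fun i : ZMod k => sg (i - 1) = false ∧ sg i = true ∧ sg (i + 1) = true),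
      sInc (ed i) (ve (i + 1)) z)
  + (∑ i ∈ Finset.univ.filter
      (fun i : ZMod k => sg (i - 1) = true ∧ sg i = false ∧ sg (i + 1) = false),
      sOne G (ed i) (G (ed i) ∩ G (ed (i + 1))) (ed (i - 1)) z)
  + (∑ i ∈ Finset.univ.filter
      (fun i : ZMod k => sg (i - 1) = true ∧ sg i = false ∧ sg (i + 1) = true),
      sTwo G (ed i) (ed (i - 1)) (ed (i + 1)) z)

/-- The set `T` of potential subsequent edge triples. -/
def Trip (G : E → Finset V) (e f g : E) : Prop :=
  (G e ∩ G f).Nonempty ∧ (G f ∩ G g).Nonempty ∧ G e ∩ G f ∩ G g = ∅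

/-- Nodes of the auxiliary graph: original nodes, intersections, and edges, each signed. -/
inductive AuxNode (V E : Type) : Type
  | vert : V → Bool → AuxNode V E
  | inter : Finset V → Bool → AuxNode V E
  | edge : E → Bool → AuxNode V E

/-- Adjacency in the auxiliary graph `Ḡ`. -/
def auxAdj (G : E → Finset V) : AuxNode V E → AuxNode V E → Prop
  | .vert v p, .edge e q => q = p ∧ v ∈ G e
  | .edge e q, .vert v p => q = p ∧ v ∈ G e
  | .inter U p, .inter W q =>
      q = !p ∧ ∃ e f g, Trip G e f g ∧ U = G e ∩ G f ∧ W = G f ∩ G g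
  | .edge e p, .inter U q => q = !p ∧ ∃ f g, Trip G e f g ∧ U = G f ∩ G g
  | .inter U q, .edge e p => q = !p ∧ ∃ f g, Trip G e f g ∧ U = G f ∩ G g
  | .edge e p, .edge g q => q = !p ∧ ∃ f, Trip G e f g
  | _, _ => False

/-- Edge lengths `ℓ̄` of the auxiliary graph (minimum over all generating triples). -/
noncomputable def auxLen (G : E → Finset V) (z : V ⊕ E → ℝ) :
    AuxNode V E → AuxNode V E → ℝ
  | .vert v _, .edge e _ => sInc e v z
  | .edge e _, .vert v _ => sInc e v z
  | .inter U _, .inter W _ =>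
      sInf { x : ℝ | ∃ e f g, Trip G e f g ∧ U = G e ∩ G f ∧ W = G f ∩ G g
        ∧ x = sOdd G f U W z }
  | .edge e _, .inter U _ =>
      sInf { x : ℝ | ∃ f g, Trip G e f g ∧ U = G f ∩ G g ∧ x = sOne G f U e z }
  | .inter U _, .edge e _ =>
      sInf { x : ℝ | ∃ f g, Trip G e f g ∧ U = G f ∩ G g ∧ x = sOne G f U e z }
  | .edge e _, .edge g _ =>
      sInf { x : ℝ | ∃ f, Trip G e f g ∧ x = sTwo G f e g z }
  | _, _ => 0

/-- Two auxiliary nodes are twins if they differ only in the sign component. -/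
def Twin : AuxNode V E → AuxNode V E → Prop
  | .vert v p, .vert w q => w = v ∧ q = !p
  | .inter U p, .inter W q => W = U ∧ q = !p
  | .edge e p, .edge f q => f = e ∧ q = !p
  | _, _ => False

/-- Total length of a walk (given as the list of visited nodes) in the auxiliary graph. -/
noncomputable def walkLen (G : E → Finset V) (z : V ⊕ E → ℝ) :
    List (AuxNode V E) → ℝ
  | a :: b :: rest => auxLen G z a b + walkLen G z (b :: rest)
  | _ => 0

/-- A twin walk in the auxiliary graph: a walk whose endpoints are twins. -/
def IsTwinWalk (G : E → Finset V) (L : List (AuxNode V E)) : Prop :=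
  L.Chain' (auxAdj G) ∧
  ∃ a b, L.head? = some a ∧ L.getLast? = some b ∧ Twin a b

/-- A cyclically indexed family of (distinct) edges forming a cycle hypergraph. -/
def IsCycleFam (m : ℕ) [NeZero m] (F : ZMod m → Finset V) : Prop :=
  3 ≤ m ∧ Function.Injective F ∧
  (∀ i : ZMod m, (F i ∩ F (i + 1)).Nonempty) ∧
  (∀ i j : ZMod m, j ≠ i - 1 → j ≠ i → j ≠ i + 1 → F i ∩ F j = ∅) ∧
  (m = 3 → F 0 ∩ F 1 ∩ F 2 = ∅)

end BPO

namespace BPO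

/-- The sign `±1` of a Boolean signature entry. -/
def sgn (b : Bool) : ℝ := if b then 1 else -1

/-- Distance of `d` from the parity value prescribed by `b`. -/
def fl (b : Bool) (d : ℝ) : ℝ := if b then d else 1 - d

theorem sgn_not (b : Bool) : sgn (!b) = -sgn b := by cases b <;> simp [sgn]

theorem sgn_mul_self (b : Bool) : sgn b * sgn b = 1 := by cases b <;> simp [sgn]

theorem prod_zmod {M : Type} [CommMonoid M] {m : ℕ} [NeZero m] (h : ZMod m → M) :
    ∏ i, h i = ∏ n ∈ range m, h (n : ZMod m) := by
  refine Finset.prod_bij' (fun i _ => i.val) (fun n _ => (n : ZMod m)) ?_ ?_ ?_ ?_ ?_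
  · intro i _; simpa using ZMod.val_lt i
  · intro n _; simp
  · intro i _; simp
  · intro n hn; exact ZMod.val_cast_of_lt (by simpa using hn)
  · intro i _; simp

theorem sum_zmod {m : ℕ} [NeZero m] (h : ZMod m → ℝ) :
    ∑ i, h i = ∑ n ∈ range m, h (n : ZMod m) := by
  refine Finset.sum_bij' (fun i _ => i.val) (fun n _ => (n : ZMod m)) ?_ ?_ ?_ ?_ ?_
  · intro i _; simpa using ZMod.val_lt i
  · intro n _; simp
  · intro i _; simp
  · intro n hn; exact ZMod.val_cast_of_lt (by simpa using hn)
  · intro i _; simp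

theorem oddSig_iff {k : ℕ} [NeZero k] (sg : ZMod k → Bool) :
    OddSig k sg ↔ ∏ i, sgn (sg i) = -1 := by
  have h : ∏ i, sgn (sg i) = (-1 : ℝ) ^ (univ.filter fun i : ZMod k => sg i = false).card := by
    rw [← Finset.prod_const, Finset.prod_filter]
    refine Finset.prod_congr rfl fun i _ => ?_
    cases sg i <;> simp [sgn]
  rw [h, OddSig]
  constructor
  · intro h; exact h.neg_one_pow
  · intro h
    by_contra hc
    rw [Nat.not_odd_iff_even] at hc
    rw [hc.neg_one_pow] at h
    norm_num at h

theorem abs_sub_prod_sgn_mul_le (α g : ℕ → ℝ) (sg : ℕ → Bool)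
    (h : ∀ n, |α n - sgn (sg n) * α (n + 1)| ≤ g n) (n : ℕ) :
    |α 0 - (∏ i ∈ range n, sgn (sg i)) * α n| ≤ ∑ i ∈ range n, g i := by
  induction n with
  | zero => simp
  | succ n ih =>
    rw [Finset.prod_range_succ, Finset.sum_range_succ]
    have h1 : |∏ i ∈ range n, sgn (sg i)| = 1 := by
      rw [Finset.abs_prod]
      exact Finset.prod_eq_one fun i _ => by cases sg i <;> simp [sgn]
    have h2 : α 0 - (∏ i ∈ range n, sgn (sg i)) * sgn (sg n) * α (n + 1)
        = (α 0 - (∏ i ∈ range n, sgn (sg i)) * α n)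
          + (∏ i ∈ range n, sgn (sg i)) * (α n - sgn (sg n) * α (n + 1)) := by ring
    rw [h2]
    refine (abs_add_le _ _).trans (add_le_add ih ?_)
    rw [abs_mul, h1, one_mul]
    exact h n

/-- Along a cycle with odd signature, if all edge terms respect the triangle bounds and one of
them attains its upper triangle bound, then the total is at least `1`. -/
theorem one_le_sum_of_tight {m : ℕ} [NeZero m] (α g : ZMod m → ℝ) (sg : ZMod m → Bool)
    (hodd : ∏ i, sgn (sg i) = -1)
    (h : ∀ i, |α (i - 1) - sgn (sg i) * α i| ≤ 2 * g i) (j : ZMod m)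
    (hj : 2 - |α (j - 1) + sgn (sg j) * α j| ≤ 2 * g j) : 1 ≤ ∑ i, g i := by
  obtain ⟨M, rfl⟩ : ∃ M, m = M + 1 := ⟨m - 1, (Nat.succ_pred (NeZero.ne m)).symm⟩
  have hlast : j + (M : ZMod (M + 1)) = j - 1 := by
    have : ((M + 1 : ℕ) : ZMod (M + 1)) = 0 := ZMod.natCast_self _
    push_cast at this
    rw [eq_sub_iff_add_eq, add_assoc, this, add_zero]
  have key := abs_sub_prod_sgn_mul_le (fun n => α (j + n)) (fun n => 2 * g (j + n + 1))
    (fun n => sg (j + n + 1)) (fun n => by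
      have := h (j + n + 1)
      rw [add_sub_cancel_right] at this
      rwa [Nat.cast_succ, ← add_assoc]) M
  have hs : ∑ i, g i = ∑ n ∈ range M, g (j + n + 1) + g j := by
    rw [← Equiv.sum_comp (Equiv.addLeft j), sum_zmod, Finset.sum_range_succ']
    simp [add_assoc]
  have hp : (∏ n ∈ range M, sgn (sg (j + n + 1))) * sgn (sg j) = -1 := by
    rw [← hodd, ← Equiv.prod_comp (Equiv.addLeft j), prod_zmod, Finset.prod_range_succ']
    simp [add_assoc]
  have hp' : (∏ n ∈ range M, sgn (sg (j + n + 1))) = - sgn (sg j) := by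
    have := sgn_mul_self (sg j)
    linear_combination sgn (sg j) * hp - (∏ n ∈ range M, sgn (sg (j + n + 1))) * this
  simp only [hp', hlast, Nat.cast_zero, add_zero, ← Finset.mul_sum] at key
  rw [hs]
  have e : |α j - -sgn (sg j) * α (j - 1)| = |α (j - 1) + sgn (sg j) * α j| := by
    cases sg j
    · simp [sgn, abs_sub_comm, ← sub_eq_add_neg]
    · simp [sgn, add_comm]
  rw [e] at key
  linarith

/-- Data of a point of the extended formulation: junction probabilities `a` and probabilities `q`
that both junctions of an edge equal one. -/
structure Feas {m : ℕ} (z ρ l u a q : ZMod m → ℝ) : Prop where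
  lower : ∀ i, l i ≤ a i
  upper : ∀ i, a i ≤ u i
  q_le_left : ∀ i, q i ≤ a (i - 1)
  q_le_right : ∀ i, q i ≤ a i
  le_q : ∀ i, a (i - 1) + a i - 1 ≤ q i
  z_le_q : ∀ i, z i ≤ q i
  q_le : ∀ i, q i ≤ z i + ρ i

/-- Probability that the two junctions of edge `i` disagree. -/
def dis {m : ℕ} (a q : ZMod m → ℝ) (i : ZMod m) : ℝ := a (i - 1) + a i - 2 * q i

/-- Linear edge term of the extended formulation. -/
def phi {m : ℕ} (z ρ : ZMod m → ℝ) (sg : ZMod m → Bool) (a : ZMod m → ℝ) (i : ZMod m) : ℝ :=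
  if sg i then a (i - 1) + a i - 2 * z i else 1 - a (i - 1) - a i + 2 * z i + 2 * ρ i

/-- Junction labels of a signed cycle. -/
def label {m : ℕ} (z l u : ZMod m → ℝ) (sg : ZMod m → Bool) (i : ZMod m) : ℝ :=
  if sg i then (if sg (i + 1) then u i else z i) else (if sg (i + 1) then z (i + 1) else l i)

/-- Room left before the edge term of `i` meets its triangle bound. -/
noncomputable def slack {m : ℕ} (z ρ : ZMod m → ℝ) (sg : ZMod m → Bool) (a : ZMod m → ℝ)
    (i : ZMod m) : ℝ :=
  if sg i then z i - (a (i - 1) + a i - 1) else min (a (i - 1)) (a i) - (z i + ρ i)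

theorem sum_phi {m : ℕ} [NeZero m] (z ρ : ZMod m → ℝ) (sg : ZMod m → Bool) (a : ZMod m → ℝ) :
    ∑ i, phi z ρ sg a i = ∑ i, (sgn (sg i) + sgn (sg (i + 1))) * a i
      + ∑ i, phi z ρ sg (fun _ => 0) i := by
  have h1 : ∑ i, sgn (sg (i + 1)) * a i = ∑ i, sgn (sg i) * a (i - 1) := by
    rw [← Equiv.sum_comp (Equiv.addRight (1 : ZMod m)) (fun i => sgn (sg i) * a (i - 1))]
    simp
  simp only [add_mul, Finset.sum_add_distrib, h1]
  simp only [← Finset.sum_add_distrib]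
  refine Finset.sum_congr rfl fun i _ => ?_
  cases h : sg i <;> simp [phi, sgn, h] <;> ring

/-- Admissible junction probabilities. -/
structure Adm {m : ℕ} (z ρ l u a : ZMod m → ℝ) : Prop where
  lower : ∀ i, l i ≤ a i
  upper : ∀ i, a i ≤ u i
  left : ∀ i, z i ≤ a i
  right : ∀ i, z i ≤ a (i - 1)
  cap : ∀ i, a (i - 1) + a i ≤ 1 + z i + ρ i

theorem Feas.abs_le_fl {m : ℕ} {z ρ l u a q : ZMod m → ℝ} (h : Feas z ρ l u a q)
    (hz : ∀ i, 0 ≤ z i) (sg : ZMod m → Bool) (i : ZMod m) :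
    |(2 * a (i - 1) - 1) - sgn (sg i) * (2 * a i - 1)| ≤ 2 * fl (sg i) (dis a q i) := by
  have h1 := h.q_le_left i
  have h2 := h.q_le_right i
  have h3 := h.le_q i
  have h4 := h.z_le_q i
  have h5 := hz i
  rw [abs_le]
  cases sg i <;> simp only [sgn, fl, dis, if_true, Bool.false_eq_true, if_false] <;>
    constructor <;> linarith

theorem Adm.exists_feas {m : ℕ} [NeZero m] {z ρ l u a : ZMod m → ℝ} (h : Adm z ρ l u a)
    (hz : ∀ i, 0 ≤ z i) (hρ : ∀ i, 0 ≤ ρ i) (hu : ∀ i, u i ≤ 1) (sg : ZMod m → Bool)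
    (hodd : ∏ i, sgn (sg i) = -1)
    (hs : (∃ i, slack z ρ sg a i ≤ 0) ∨
      ((∀ i, 0 ≤ slack z ρ sg a i) ∧ 1 ≤ ∑ i, phi z ρ sg a i)) :
    ∃ q, Feas z ρ l u a q ∧ 1 ≤ ∑ i, fl (sg i) (dis a q i) := by
  set q : ZMod m → ℝ := fun i => if sg i then max (z i) (a (i - 1) + a i - 1) else
    min (min (a (i - 1)) (a i)) (z i + ρ i) with hq
  have a1 : ∀ i, a i ≤ 1 := fun i => (h.upper i).trans (hu i)
  have hF : Feas z ρ l u a q := by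
    refine ⟨h.lower, h.upper, ?_, ?_, ?_, ?_, ?_⟩ <;> intro i <;>
    · have := h.left i
      have := h.right i
      have := h.cap i
      have := a1 i
      have := a1 (i - 1)
      have := hρ i
      have := hz i
      simp only [hq]
      cases sg i <;> simp <;> grind
  refine ⟨q, hF, ?_⟩
  rcases hs with ⟨j, hj⟩ | ⟨hs, hphi⟩
  · refine one_le_sum_of_tight (fun i => 2 * a i - 1) _ sg hodd (hF.abs_le_fl hz sg) j ?_
    have b1 := neg_abs_le (2 * a (j - 1) - 1 + sgn (sg j) * (2 * a j - 1))
    have b2 := le_abs_self (2 * a (j - 1) - 1 + sgn (sg j) * (2 * a j - 1))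
    simp only [slack] at hj
    simp only [dis, hq]
    cases hsj : sg j <;> simp [hsj, sgn, fl] at hj b1 b2 ⊢ <;> grind
  · refine hphi.trans (Finset.sum_le_sum fun i _ => ?_)
    have := hs i
    simp only [slack] at this
    simp only [phi, dis, hq]
    cases hsj : sg i <;> simp [hsj, fl] at this ⊢ <;> grind

theorem exists_feas_of_label {m : ℕ} [NeZero m] {z ρ l u : ZMod m → ℝ}
    (hz : ∀ i, 0 ≤ z i) (hρ : ∀ i, 0 ≤ ρ i) (hu : ∀ i, u i ≤ 1) {a₀ : ZMod m → ℝ}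
    (h₀ : Adm z ρ l u a₀) (sg : ZMod m → Bool) (hodd : ∏ i, sgn (sg i) = -1)
    (hl : 1 ≤ ∑ i, phi z ρ sg (label z l u sg) i) :
    ∃ a q, Feas z ρ l u a q ∧ 1 ≤ ∑ i, fl (sg i) (dis a q i) := by
  by_cases hc : ∃ i, slack z ρ sg a₀ i ≤ 0
  · exact ⟨a₀, h₀.exists_feas hz hρ hu sg hodd (Or.inl hc)⟩
  push Not at hc
  set a₁ : ZMod m → ℝ := fun i => if sg i = sg (i + 1) then label z l u sg i else a₀ i with ha₁
  have lu : ∀ i, l i ≤ u i := fun i => (h₀.lower i).trans (h₀.upper i)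
  have key : ∀ t ∈ Set.Icc (0 : ℝ) 1, (∀ i, 0 ≤ slack z ρ sg (fun i => a₀ i + t * (a₁ i - a₀ i)) i)
      → Adm z ρ l u (fun i => a₀ i + t * (a₁ i - a₀ i)) := by
    rintro t ⟨t0, t1⟩ hs
    have hup : ∀ i, sg i = true ∨ sg (i + 1) = true → 0 ≤ t * (a₁ i - a₀ i) := by
      intro i hi
      refine mul_nonneg t0 ?_
      have := h₀.upper i
      simp only [ha₁, label]
      cases h1 : sg i <;> cases h2 : sg (i + 1) <;> simp [h1, h2] at hi ⊢
      linarith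
    have hdn : ∀ i, sg i = false ∨ sg (i + 1) = false → t * (a₁ i - a₀ i) ≤ 0 := by
      intro i hi
      refine mul_nonpos_of_nonneg_of_nonpos t0 ?_
      have := h₀.lower i
      simp only [ha₁, label]
      cases h1 : sg i <;> cases h2 : sg (i + 1) <;> simp [h1, h2] at hi ⊢
      linarith
    have hr : ∀ i, l i ≤ a₁ i ∧ a₁ i ≤ u i := by
      intro i
      have := h₀.lower i
      have := h₀.upper i
      have := lu i
      simp only [ha₁, label]
      cases h1 : sg i <;> cases h2 : sg (i + 1) <;> simp [*]
    refine ⟨?_, ?_, ?_, ?_, ?_⟩ <;> intro i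
    · have := mul_nonneg t0 (sub_nonneg.2 (hr i).1)
      have := mul_nonneg (sub_nonneg.2 t1) (sub_nonneg.2 (h₀.lower i))
      nlinarith
    · have := mul_nonneg t0 (sub_nonneg.2 (hr i).2)
      have := mul_nonneg (sub_nonneg.2 t1) (sub_nonneg.2 (h₀.upper i))
      nlinarith
    · cases h1 : sg i
      · have := hs i
        have := hρ i
        simp [slack, h1] at *
        linarith
      · have := hup i (Or.inl h1)
        have := h₀.left i
        linarith
    · cases h1 : sg i
      · have := hs i
        have := hρ i
        simp [slack, h1] at *
        linarith
      · have := hup (i - 1) (Or.inr (by simpa using h1))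
        have := h₀.right i
        linarith
    · cases h1 : sg i
      · have := hdn i (Or.inl h1)
        have := hdn (i - 1) (Or.inr (by simpa using h1))
        have := h₀.cap i
        linarith
      · have := hs i
        have := hρ i
        simp [slack, h1] at *
        linarith
  have hphi : ∑ i, phi z ρ sg a₁ i = ∑ i, phi z ρ sg (label z l u sg) i := by
    rw [sum_phi, sum_phi z ρ sg (label z l u sg)]
    congr 1
    refine Finset.sum_congr rfl fun i _ => ?_
    simp only [ha₁]
    cases h1 : sg i <;> cases h2 : sg (i + 1) <;> simp [sgn]
  by_cases hc1 : ∀ i, 0 ≤ slack z ρ sg a₁ i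
  · have e : (fun i => a₀ i + 1 * (a₁ i - a₀ i)) = a₁ := by ext i; ring
    have hA := key 1 ⟨zero_le_one, le_rfl⟩ (by rwa [e])
    rw [e] at hA
    exact ⟨a₁, hA.exists_feas hz hρ hu sg hodd (Or.inr ⟨hc1, hphi ▸ hl⟩)⟩
  push Not at hc1
  obtain ⟨j, hj⟩ := hc1
  let c : ℝ → ℝ := fun t => univ.inf' univ_nonempty
    (fun i => slack z ρ sg (fun i => a₀ i + t * (a₁ i - a₀ i)) i)
  have hcont : Continuous c := by
    refine Continuous.finset_inf'_apply _ fun i _ => ?_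
    unfold slack
    split_ifs <;> fun_prop
  have c0 : 0 ≤ c 0 := by
    simp only [c, Finset.le_inf'_iff]
    intro i _
    simpa using (hc i).le
  have c1 : c 1 ≤ 0 := by
    refine (Finset.inf'_le _ (mem_univ j)).trans ?_
    have e : (fun i => a₀ i + 1 * (a₁ i - a₀ i)) = a₁ := by ext i; ring
    rw [e]
    exact hj.le
  obtain ⟨t, ht, ht0⟩ := intermediate_value_Icc' zero_le_one hcont.continuousOn ⟨c1, c0⟩
  have hnn : ∀ i, 0 ≤ slack z ρ sg (fun i => a₀ i + t * (a₁ i - a₀ i)) i := fun i =>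
    ht0 ▸ Finset.inf'_le _ (mem_univ i)
  obtain ⟨i, _, hi⟩ := Finset.exists_mem_eq_inf' (s := univ) univ_nonempty
    (fun i => slack z ρ sg (fun i => a₀ i + t * (a₁ i - a₀ i)) i)
  exact ⟨_, (key t ht hnn).exists_feas hz hρ hu sg hodd (Or.inl ⟨i, by rw [← hi]; exact ht0.le⟩)⟩

/-- Two distinct odd signatures cannot both be closer than `1`. -/
theorem two_le_sum_add_sum {m : ℕ} [NeZero m] {sg sg' : ZMod m → Bool} (hne : sg ≠ sg')
    (h : ∏ i, sgn (sg i) = -1) (h' : ∏ i, sgn (sg' i) = -1) (d : ZMod m → ℝ)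
    (hd : ∀ b i, 0 ≤ fl b (d i)) :
    2 ≤ ∑ i, fl (sg i) (d i) + ∑ i, fl (sg' i) (d i) := by
  obtain ⟨i, hi⟩ := Function.ne_iff.1 hne
  obtain ⟨j, hji, hj⟩ : ∃ j, j ≠ i ∧ sg j ≠ sg' j := by
    by_contra! hc
    rw [← Finset.mul_prod_erase _ _ (mem_univ i)] at h h'
    have e : ∏ j ∈ univ.erase i, sgn (sg j) = ∏ j ∈ univ.erase i, sgn (sg' j) :=
      Finset.prod_congr rfl fun j hj => by rw [hc j (Finset.ne_of_mem_erase hj)]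
    have e2 : sgn (sg i) = - sgn (sg' i) := by
      rw [← sgn_not]
      congr 1
      revert hi; cases sg i <;> cases sg' i <;> simp
    rw [e, e2] at h
    linarith
  have hone : ∀ k, sg k ≠ sg' k → fl (sg k) (d k) + fl (sg' k) (d k) = 1 := by
    intro k hk
    revert hk; cases sg k <;> cases sg' k <;> simp [fl]
  rw [← Finset.sum_add_distrib]
  calc (2 : ℝ) = ∑ k ∈ {i, j}, (fl (sg k) (d k) + fl (sg' k) (d k)) := by
        rw [Finset.sum_pair hji.symm, hone i hi, hone j hj]; norm_num
    _ ≤ _ := Finset.sum_le_sum_of_subset_of_nonneg (subset_univ _)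
        fun k _ _ => add_nonneg (hd _ _) (hd _ _)

theorem exists_feas_forall {m : ℕ} [NeZero m] {z ρ l u : ZMod m → ℝ}
    (hz : ∀ i, 0 ≤ z i) (hρ : ∀ i, 0 ≤ ρ i) (hu : ∀ i, u i ≤ 1) {a₀ : ZMod m → ℝ}
    (h₀ : Adm z ρ l u a₀)
    (hl : ∀ sg : ZMod m → Bool, ∏ i, sgn (sg i) = -1 →
      1 ≤ ∑ i, phi z ρ sg (label z l u sg) i) :
    ∃ a q, Feas z ρ l u a q ∧ ∀ sg : ZMod m → Bool, ∏ i, sgn (sg i) = -1 →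
      1 ≤ ∑ i, fl (sg i) (dis a q i) := by
  have hex := fun sg hodd => exists_feas_of_label hz hρ hu h₀ sg hodd (hl sg hodd)
  obtain ⟨a, q, hF, -⟩ := hex (fun i => decide (i ≠ 0)) (by
    rw [← Finset.mul_prod_erase _ _ (mem_univ 0), Finset.prod_eq_one]
    · simp [sgn]
    · intro i hi; simp [sgn, Finset.ne_of_mem_erase hi])
  by_cases hall : ∀ sg : ZMod m → Bool, ∏ i, sgn (sg i) = -1 → 1 ≤ ∑ i, fl (sg i) (dis a q i)
  · exact ⟨a, q, hF, hall⟩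
  push Not at hall
  obtain ⟨sg, hodd, hlt⟩ := hall
  obtain ⟨a', q', hF', hge⟩ := hex sg hodd
  set A := ∑ i, fl (sg i) (dis a q i) with hA
  set B := ∑ i, fl (sg i) (dis a' q' i) with hB
  set t := (1 - A) / (B - A) with ht
  have hAB : 0 < B - A := by linarith
  have t0 : 0 ≤ t := div_nonneg (by linarith) hAB.le
  have t1 : t ≤ 1 := (div_le_one hAB).2 (by linarith)
  have htAB : t * (B - A) = 1 - A := div_mul_cancel₀ _ hAB.ne'
  have mix : ∀ {x y x' y' : ℝ}, x ≤ y → x' ≤ y' → (1 - t) * x + t * x' ≤ (1 - t) * y + t * y' :=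
    fun h h' => add_le_add (mul_le_mul_of_nonneg_left h (by linarith))
      (mul_le_mul_of_nonneg_left h' t0)
  have hFt : Feas z ρ l u (fun i => (1 - t) * a i + t * a' i)
      (fun i => (1 - t) * q i + t * q' i) := by
    refine ⟨?_, ?_, ?_, ?_, ?_, ?_, ?_⟩ <;> intro i
    · linarith [mix (hF.lower i) (hF'.lower i)]
    · linarith [mix (hF.upper i) (hF'.upper i)]
    · linarith [mix (hF.q_le_left i) (hF'.q_le_left i)]
    · linarith [mix (hF.q_le_right i) (hF'.q_le_right i)]
    · linarith [mix (hF.le_q i) (hF'.le_q i)]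
    · linarith [mix (hF.z_le_q i) (hF'.z_le_q i)]
    · linarith [mix (hF.q_le i) (hF'.q_le i)]
  refine ⟨_, _, hFt, fun sg' hodd' => ?_⟩
  have hone : ∑ i, fl (sg i) (dis (fun i => (1 - t) * a i + t * a' i)
      (fun i => (1 - t) * q i + t * q' i) i) = 1 := by
    have : (1 - t) * A + t * B = 1 := by linarith
    refine Eq.trans ?_ this
    rw [hA, hB, Finset.mul_sum, Finset.mul_sum, ← Finset.sum_add_distrib]
    refine Finset.sum_congr rfl fun i _ => ?_
    cases sg i <;> simp [fl, dis] <;> ring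
  by_cases he : sg = sg'
  · rw [← he, hone]
  · have := two_le_sum_add_sum he hodd hodd' _ fun b i => by
      have := (abs_nonneg _).trans (hFt.abs_le_fl hz (fun _ => b) i)
      exact nonneg_of_mul_nonneg_right this two_pos
    linarith

end BPO

namespace BPO

/-- Positive normalized linear functionals (expectations) on real functions. -/
structure IsMean {Ω : Type} (L : (Ω → ℝ) →ₗ[ℝ] ℝ) : Prop where
  nonneg : ∀ f, (∀ x, 0 ≤ f x) → 0 ≤ L f
  one : L (fun _ => 1) = 1

/-- Pushing an expectation through a finitely branching Markov kernel. -/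
theorem IsMean.exists_kernel {Ω Ω' B : Type} [Fintype B] {L : (Ω → ℝ) →ₗ[ℝ] ℝ} (hL : IsMean L)
    (k : B → Ω → ℝ) (g : B → Ω → Ω') (hk : ∀ b x, 0 ≤ k b x) (hk1 : ∀ x, ∑ b, k b x = 1) :
    ∃ L' : (Ω' → ℝ) →ₗ[ℝ] ℝ, IsMean L' ∧ ∀ f, L' f = L (fun x => ∑ b, k b x * f (g b x)) := by
  let K : (Ω' → ℝ) →ₗ[ℝ] (Ω → ℝ) :=
    { toFun := fun f x => ∑ b, k b x * f (g b x)
      map_add' := fun f f' => by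
        ext x; simp [mul_add, Finset.sum_add_distrib]
      map_smul' := fun c f => by
        ext x
        simp only [Pi.smul_apply, smul_eq_mul, RingHom.id_apply, Finset.mul_sum]
        exact Finset.sum_congr rfl fun b _ => by ring }
  refine ⟨L ∘ₗ K, ⟨fun f hf => ?_, ?_⟩, fun f => rfl⟩
  · exact hL.nonneg _ fun x => Finset.sum_nonneg fun b _ => mul_nonneg (hk b x) (hf _)
  · change L (fun x => ∑ b, k b x * 1) = 1
    simp only [mul_one, hk1, hL.one]

theorem exists_isMean_dirac {Ω : Type} (x : Ω) :
    ∃ L : (Ω → ℝ) →ₗ[ℝ] ℝ, IsMean L ∧ ∀ f, L f = f x :=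
  ⟨LinearMap.proj x, ⟨fun f hf => hf x, rfl⟩, fun _ => rfl⟩

theorem IsMean.mono {Ω : Type} {L : (Ω → ℝ) →ₗ[ℝ] ℝ} (hL : IsMean L) {f g : Ω → ℝ}
    (h : ∀ x, f x ≤ g x) : L f ≤ L g := by
  have := hL.nonneg (g - f) fun x => sub_nonneg.2 (h x)
  rw [map_sub] at this
  linarith

/-- The real value `0` or `1` of a Boolean. -/
def ind (b : Bool) : ℝ := if b then 1 else 0

@[simp] theorem ind_true : ind true = 1 := rfl

@[simp] theorem ind_false : ind false = 0 := rfl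

/-- Shortest distance from `d` to sequences of prescribed parity on the first `n` edges. -/
noncomputable def pathDist (d : ℕ → ℝ) : Bool → ℕ → ℝ
  | b, 0 => if b then 0 else 1
  | b, n + 1 => min (pathDist d b n + d n) (pathDist d (!b) n + (1 - d n))

theorem pathDist_attained (d : ℕ → ℝ) (hd : ∀ n, 0 ≤ d n ∧ d n ≤ 1) (n : ℕ) (b : Bool) :
    1 ≤ pathDist d b n ∨ ∃ sg : ℕ → Bool, ∏ i ∈ range n, sgn (sg i) = sgn b ∧
      ∑ i ∈ range n, fl (sg i) (d i) = pathDist d b n := by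
  induction n generalizing b with
  | zero =>
    cases b
    · left; simp [pathDist]
    · right; exact ⟨fun _ => true, by simp [pathDist, sgn]⟩
  | succ n ih =>
    have step : ∀ c c' : Bool, sgn c * sgn c' = sgn b →
        pathDist d b (n + 1) = pathDist d c n + fl c' (d n) →
        1 ≤ pathDist d b (n + 1) ∨ ∃ sg : ℕ → Bool, ∏ i ∈ range (n + 1), sgn (sg i) = sgn b ∧
          ∑ i ∈ range (n + 1), fl (sg i) (d i) = pathDist d b (n + 1) := by
      intro c c' hcc he
      rcases ih c with h | ⟨sg, h1, h2⟩
      · left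
        rw [he]
        have : 0 ≤ fl c' (d n) := by cases c' <;> simp [fl, hd n]
        linarith
      · right
        refine ⟨Function.update sg n c', ?_, ?_⟩
        · rw [Finset.prod_range_succ, Function.update_self, ← hcc, ← h1]
          congr 1
          refine Finset.prod_congr rfl fun i hi => ?_
          rw [Function.update_of_ne (Finset.mem_range.1 hi).ne]
        · rw [Finset.sum_range_succ, Function.update_self, he, ← h2]
          congr 1
          refine Finset.sum_congr rfl fun i hi => ?_
          rw [Function.update_of_ne (Finset.mem_range.1 hi).ne]
    rcases min_choice (pathDist d b n + d n) (pathDist d (!b) n + (1 - d n)) with h | h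
    · exact step b true (by simp [sgn]) (by simpa [pathDist, fl] using h)
    · exact step (!b) false (by rw [sgn_not]; simp [sgn]) (by simpa [pathDist, fl] using h)

/-- The local bounds for the disagreement probability `d` of two Boolean variables of
means `a` and `b`. -/
structure Dis (a b d : ℝ) : Prop where
  sub_le : a - b ≤ d
  sub_le' : b - a ≤ d
  le_add : d ≤ a + b
  le_two : d ≤ 2 - a - b

theorem Dis.mem {a b d : ℝ} (h : Dis a b d) : 0 ≤ d ∧ d ≤ 1 := by
  obtain ⟨h1, h2, h3, h4⟩ := h
  constructor <;> linarith

theorem pathDist_bounds {a d : ℕ → ℝ} (ha : ∀ n, 0 ≤ a n ∧ a n ≤ 1)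
    (hd : ∀ n, Dis (a n) (a (n + 1)) (d n)) (n : ℕ) :
    1 ≤ pathDist d true n + pathDist d false n ∧
    a 0 - a n ≤ pathDist d true n ∧ a n - a 0 ≤ pathDist d true n ∧
    a 0 + a n - 1 ≤ pathDist d false n ∧ 1 - a 0 - a n ≤ pathDist d false n := by
  induction n with
  | zero =>
    have := ha 0
    simp [pathDist]
    constructor <;> linarith
  | succ n ih =>
    obtain ⟨h1, h2, h3, h4⟩ := hd n
    have := ha n
    have := ha 0
    have := ha (n + 1)
    simp only [pathDist, Bool.not_true, Bool.not_false]
    refine ⟨?_, ?_, ?_, ?_, ?_⟩ <;> grind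

theorem exists_between_list (l u : List ℝ) (hl : l ≠ []) (h : ∀ x ∈ l, ∀ y ∈ u, x ≤ y) :
    ∃ t, (∀ x ∈ l, x ≤ t) ∧ ∀ y ∈ u, t ≤ y := by
  have hne : l.toFinset.Nonempty := by simpa using hl
  refine ⟨l.toFinset.max' hne, fun x hx => Finset.le_max' _ _ (by simpa using hx), fun y hy => ?_⟩
  exact h _ (by simpa using Finset.max'_mem _ hne) y hy

theorem exists_mul_eq_of_le {p r : ℝ} (h0 : 0 ≤ p) (h1 : p ≤ r) :
    ∃ κ : ℝ, 0 ≤ κ ∧ κ ≤ 1 ∧ κ * r = p := by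
  rcases (h0.trans h1).eq_or_lt with h | h
  · exact ⟨0, le_rfl, zero_le_one, by linarith⟩
  · exact ⟨p / r, div_nonneg h0 h.le, (div_le_one h).2 h1, div_mul_cancel₀ _ (ne_of_gt h)⟩

/-- Given two correlated Boolean variables, a third variable with prescribed correlations exists,
provided that the local bounds and the triangle inequalities hold. -/
theorem IsMean.exists_third {Ω Ω' : Type} {L : (Ω → ℝ) →ₗ[ℝ] ℝ} (hL : IsMean L)
    (X Y : Ω → Bool) (g : Bool → Ω → Ω') {a b c d e f : ℝ}
    (hX : L (fun x => ind (X x)) = a) (hY : L (fun x => ind (Y x)) = b)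
    (hXY : 2 * L (fun x => ind (X x) * ind (Y x)) = a + b - d)
    (hd : Dis a b d) (he : Dis b c e) (hf : Dis a c f)
    (h1 : d ≤ e + f) (h2 : e ≤ d + f) (h3 : f ≤ d + e) (h4 : d + e + f ≤ 2) :
    ∃ L' : (Ω' → ℝ) →ₗ[ℝ] ℝ, IsMean L' ∧
      (∀ F : Ω' → ℝ, (∀ x, F (g true x) = F (g false x)) → L' F = L (fun x => F (g true x))) ∧
      (∀ F : Ω → ℝ, ∀ F' : Ω' → ℝ, (∀ x, F' (g true x) = F x) → (∀ x, F' (g false x) = 0) →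
        (F = (fun _ => 1) → L' F' = c) ∧
        (F = (fun x => ind (X x)) → 2 * L' F' = a + c - f) ∧
        (F = (fun x => ind (Y x)) → 2 * L' F' = b + c - e)) := by
  have := hd.mem
  have := he.mem
  have := hf.mem
  obtain ⟨d1, d2, d3, d4⟩ := hd
  obtain ⟨e1, e2, e3, e4⟩ := he
  obtain ⟨f1, f2, f3, f4⟩ := hf
  obtain ⟨t, ht, ht'⟩ := exists_between_list
    [0, (b + c - e) / 2 - (b - a + d) / 2, (a + c - f) / 2 - (a - b + d) / 2,
      (b + c - e) / 2 + (a + c - f) / 2 - c]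
    [(a + b - d) / 2, (b + c - e) / 2, (a + c - f) / 2,
      (2 - a - b - d) / 2 + (b + c - e) / 2 + (a + c - f) / 2 - c] (by simp) (by
      simp only [List.mem_cons, List.not_mem_nil, or_false]
      rintro x (rfl | rfl | rfl | rfl) y (rfl | rfl | rfl | rfl) <;> linarith)
  simp only [List.mem_cons, List.not_mem_nil, or_false, forall_eq_or_imp, forall_eq] at ht ht'
  obtain ⟨l1, l2, l3, l4⟩ := ht
  obtain ⟨u1, u2, u3, u4⟩ := ht'
  obtain ⟨k11, k11n, k11l, k11e⟩ := exists_mul_eq_of_le l1 u1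
  obtain ⟨k10, k10n, k10l, k10e⟩ := exists_mul_eq_of_le (p := (a + c - f) / 2 - t)
    (r := (a - b + d) / 2) (by linarith) (by linarith)
  obtain ⟨k01, k01n, k01l, k01e⟩ := exists_mul_eq_of_le (p := (b + c - e) / 2 - t)
    (r := (b - a + d) / 2) (by linarith) (by linarith)
  obtain ⟨k00, k00n, k00l, k00e⟩ := exists_mul_eq_of_le
    (p := c - (b + c - e) / 2 - (a + c - f) / 2 + t) (r := (2 - a - b - d) / 2) (by linarith) (by linarith)
  let κ : Ω → ℝ := fun x => if X x then (if Y x then k11 else k10) else (if Y x then k01 else k00)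
  have κ0 : ∀ x, 0 ≤ κ x := by intro x; simp only [κ]; split_ifs <;> assumption
  have κ1 : ∀ x, κ x ≤ 1 := by intro x; simp only [κ]; split_ifs <;> assumption
  obtain ⟨L', hL', hLL⟩ := hL.exists_kernel (fun b x => if b then κ x else 1 - κ x) g
    (by intro b x; have := κ0 x; have := κ1 x; cases b <;> simp [*]) (by intro x; simp)
  simp only [Fintype.sum_bool, if_true, Bool.false_eq_true, if_false] at hLL
  refine ⟨L', hL', ?_, ?_⟩
  · intro F hF
    rw [hLL]
    congr 1
    ext x
    rw [hF]
    ring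
  · intro F F' hT hN
    have hF' : L' F' = L (fun x => κ x * F x) := by
      rw [hLL]
      simp [hT, hN]
    have lin : ∀ c0 c1 c2 c3 : ℝ, L (fun x => c0 + c1 * ind (X x) + c2 * ind (Y x)
        + c3 * (ind (X x) * ind (Y x))) = c0 + c1 * a + c2 * b + c3 * ((a + b - d) / 2) := by
      intro c0 c1 c2 c3
      have : (fun x => c0 + c1 * ind (X x) + c2 * ind (Y x) + c3 * (ind (X x) * ind (Y x)))
          = c0 • (fun _ => (1 : ℝ)) + c1 • (fun x => ind (X x)) + c2 • (fun x => ind (Y x))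
            + c3 • (fun x => ind (X x) * ind (Y x)) := by
        ext x; simp
      rw [this]
      have hXY' : L (fun x => ind (X x) * ind (Y x)) = (a + b - d) / 2 := by linarith
      simp only [map_add, map_smul, smul_eq_mul, hL.one, hX, hY, hXY', mul_one]
    refine ⟨?_, ?_, ?_⟩ <;> rintro rfl <;> rw [hF']
    · have : (fun x => κ x * 1) = fun x => k00 + (k10 - k00) * ind (X x)
          + (k01 - k00) * ind (Y x) + (k11 - k10 - k01 + k00) * (ind (X x) * ind (Y x)) := by
        ext x; simp only [κ]; cases X x <;> cases Y x <;> simp <;> ring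
      rw [this, lin]
      linarith
    · have : (fun x => κ x * ind (X x)) = fun x => 0 + k10 * ind (X x)
          + 0 * ind (Y x) + (k11 - k10) * (ind (X x) * ind (Y x)) := by
        ext x; simp only [κ]; cases X x <;> cases Y x <;> simp
      rw [this, lin]
      linarith
    · have : (fun x => κ x * ind (Y x)) = fun x => 0 + 0 * ind (X x)
          + k01 * ind (Y x) + (k11 - k01) * (ind (X x) * ind (Y x)) := by
        ext x; simp only [κ]; cases X x <;> cases Y x <;> simp
      rw [this, lin]
      linarith

/-- Realizability of pairwise marginals along a path together with the pair of its end points. -/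
theorem exists_isMean_path {a d : ℕ → ℝ} (ha : ∀ n, 0 ≤ a n ∧ a n ≤ 1)
    (hd : ∀ n, Dis (a n) (a (n + 1)) (d n)) (n : ℕ) (x : ℝ) (hx : Dis (a 0) (a n) x)
    (h1 : 1 - pathDist d false n ≤ x) (h2 : x ≤ pathDist d true n) :
    ∃ L : ((ℕ → Bool) → ℝ) →ₗ[ℝ] ℝ, IsMean L ∧ (∀ i ≤ n, L (fun w => ind (w i)) = a i) ∧
      (∀ i < n, 2 * L (fun w => ind (w i) * ind (w (i + 1))) = a i + a (i + 1) - d i) ∧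
      2 * L (fun w => ind (w 0) * ind (w n)) = a 0 + a n - x := by
  induction n generalizing x with
  | zero =>
    obtain ⟨L₀, hL₀, hf₀⟩ := exists_isMean_dirac ()
    obtain ⟨L, hL, hf⟩ := hL₀.exists_kernel (fun b _ => if b then a 0 else 1 - a 0)
      (fun (b : Bool) _ (_ : ℕ) => b)
      (by intro b _; have := ha 0; cases b <;> simp [*]) (by intro x; simp)
    have hx0 : x = 0 := by simp [pathDist] at h1 h2; linarith
    have h0 : L (fun w => ind (w 0)) = a 0 := by simp [hf, hf₀]
    refine ⟨L, hL, by simpa using h0, by simp, ?_⟩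
    have : (fun w : ℕ → Bool => ind (w 0) * ind (w 0)) = fun w => ind (w 0) := by
      ext w; cases w 0 <;> simp
    rw [this, h0, hx0]
    ring
  | succ n ih =>
    obtain ⟨p1, p2, p3, p4, p5⟩ := pathDist_bounds ha hd n
    obtain ⟨d1, d2, d3, d4⟩ := hd n
    obtain ⟨x1, x2, x3, x4⟩ := hx
    simp only [pathDist, Bool.not_true, Bool.not_false, le_min_iff] at h1 h2
    have h1' : 1 - x ≤ pathDist d false n + d n ∧ 1 - x ≤ pathDist d true n + (1 - d n) :=
      le_min_iff.1 (by linarith)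
    have a0 := ha 0
    have an := ha n
    have an1 := ha (n + 1)
    obtain ⟨y, hy, hy'⟩ := exists_between_list
      [a 0 - a n, a n - a 0, 1 - pathDist d false n, d n - x, x - d n]
      [a 0 + a n, 2 - a 0 - a n, pathDist d true n, d n + x, 2 - d n - x] (by simp) (by
      simp only [List.mem_cons, List.not_mem_nil, or_false]
      rintro s (rfl | rfl | rfl | rfl | rfl) t (rfl | rfl | rfl | rfl | rfl) <;> linarith)
    simp only [List.mem_cons, List.not_mem_nil, or_false, forall_eq_or_imp, forall_eq] at hy hy'
    obtain ⟨l1, l2, l3, l4, l5⟩ := hy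
    obtain ⟨u1, u2, u3, u4, u5⟩ := hy'
    obtain ⟨L, hL, hi, hii, h0n⟩ := ih y ⟨l1, l2, u1, u2⟩ l3 u3
    obtain ⟨L', hL', hinv, hnew⟩ := hL.exists_third (fun w => w 0) (fun w => w n)
      (fun b w => Function.update w (n + 1) b) (hi 0 (Nat.zero_le n)) (hi n le_rfl) h0n
      ⟨l1, l2, u1, u2⟩ ⟨d1, d2, d3, d4⟩ ⟨x1, x2, x3, x4⟩ (by linarith) (by linarith)
      (by linarith) (by linarith)
    refine ⟨L', hL', ?_, ?_, ?_⟩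
    · intro i hin
      rcases hin.lt_or_eq with h | rfl
      · rw [hinv _ (by intro w; simp [h.ne])]
        simp only [Function.update_of_ne h.ne]
        exact hi i (by lia)
      · exact (hnew (fun _ => 1) _ (by simp) (by simp)).1 rfl
    · intro i hin
      rcases (Nat.lt_succ_iff.1 hin).lt_or_eq with h | rfl
      · have e1 : i ≠ n + 1 := by lia
        have e2 : i + 1 ≠ n + 1 := by lia
        rw [hinv _ (by intro w; simp [e1, h.ne])]
        simp only [Function.update_of_ne e1, Function.update_of_ne e2]
        exact hii i h
      · exact (hnew (fun w => ind (w i)) _ (by simp) (by simp)).2.2 rfl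
    · exact (hnew (fun w => ind (w 0)) _ (by simp) (by simp)).2.1 rfl

/-- The odd cycle inequalities characterize realizable pairwise marginals along a cycle. -/
theorem exists_isMean_cycle {m : ℕ} [NeZero m] {a q : ZMod m → ℝ} (ha : ∀ i, 0 ≤ a i ∧ a i ≤ 1)
    (hd : ∀ i, Dis (a (i - 1)) (a i) (dis a q i))
    (hodd : ∀ sg : ZMod m → Bool, ∏ i, sgn (sg i) = -1 → 1 ≤ ∑ i, fl (sg i) (dis a q i)) :
    ∃ L : ((ZMod m → Bool) → ℝ) →ₗ[ℝ] ℝ, IsMean L ∧ (∀ i, L (fun w => ind (w i)) = a i) ∧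
      ∀ i, L (fun w => ind (w (i - 1)) * ind (w i)) = q i := by
  obtain ⟨M, rfl⟩ : ∃ M, m = M + 1 := ⟨m - 1, (Nat.succ_pred (NeZero.ne m)).symm⟩
  have hlast : (M : ZMod (M + 1)) = 0 - 1 := by
    have : ((M + 1 : ℕ) : ZMod (M + 1)) = 0 := ZMod.natCast_self _
    push_cast at this
    rw [eq_sub_iff_add_eq, this]
  set a' : ℕ → ℝ := fun n => a n with ha'
  set d' : ℕ → ℝ := fun n => dis a q (n + 1 : ℕ) with hd'
  have hdd : ∀ n, Dis (a' n) (a' (n + 1)) (d' n) := by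
    intro n
    have := hd (n + 1 : ℕ)
    simpa [ha', hd'] using this
  have h0 : Dis (a' 0) (a' M) (dis a q 0) := by
    obtain ⟨h1, h2, h3, h4⟩ := hd 0
    simp only [ha', hlast, Nat.cast_zero]
    constructor <;> linarith
  have hpar : ∀ b : Bool, 1 ≤ pathDist d' b M + fl (!b) (dis a q 0) := by
    intro b
    have hm := (hd 0).mem
    rcases pathDist_attained d' (fun n => (hdd n).mem) M b with h | ⟨sg, hp, hs⟩
    · have : 0 ≤ fl (!b) (dis a q 0) := by cases b <;> simp [fl, hm]
      linarith
    · have := hodd (fun i => if i.val = 0 then !b else sg (i.val - 1)) ?_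
      · rw [sum_zmod, Finset.sum_range_succ', Nat.cast_zero, ZMod.val_zero, if_pos rfl] at this
        rw [← hs]
        refine this.trans (add_le_add (le_of_eq (Finset.sum_congr rfl fun i hi => ?_)) le_rfl)
        rw [ZMod.val_cast_of_lt (by simpa using hi)]
        simp [hd']
      · rw [prod_zmod, Finset.prod_range_succ', Nat.cast_zero, ZMod.val_zero, if_pos rfl]
        have : ∏ i ∈ range M, sgn (if ((i + 1 : ℕ) : ZMod (M + 1)).val = 0 then !b
            else sg (((i + 1 : ℕ) : ZMod (M + 1)).val - 1)) = sgn b := by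
          rw [← hp]
          refine Finset.prod_congr rfl fun i hi => ?_
          rw [ZMod.val_cast_of_lt (by simpa using hi)]
          simp
        rw [this, sgn_not]
        have := sgn_mul_self b
        linarith
  obtain ⟨L, hL, h1, h2, h3⟩ := exists_isMean_path (fun n => ha n) hdd M (dis a q 0) h0
    (by have := hpar false; simp [fl] at this; linarith)
    (by have := hpar true; simp [fl] at this; linarith)
  obtain ⟨L', hL', hLL⟩ := hL.exists_kernel (B := Unit) (fun _ _ => 1)
    (fun _ w (i : ZMod (M + 1)) => w i.val) (by simp) (by simp)
  simp only [Finset.univ_unique, Finset.sum_singleton, one_mul] at hLL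
  refine ⟨L', hL', fun i => ?_, fun i => ?_⟩
  · rw [hLL, h1 _ (Nat.lt_succ_iff.1 (ZMod.val_lt i))]
    simp
  · rw [hLL]
    by_cases hi : i = 0
    · subst hi
      have e : (0 - 1 : ZMod (M + 1)).val = M := by
        rw [← hlast, ZMod.val_cast_of_lt (Nat.lt_succ_self M)]
      simp only [e, ZMod.val_zero]
      have hc : (fun w : ℕ → Bool => ind (w M) * ind (w 0)) = fun w => ind (w 0) * ind (w M) := by
        ext w; exact mul_comm _ _
      rw [hc]
      simp only [hlast, dis, Nat.cast_zero] at h3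
      linarith
    · obtain ⟨n, hn⟩ : ∃ n, i.val = n + 1 :=
        ⟨i.val - 1, (Nat.succ_pred (by simpa using hi)).symm⟩
      have hin : i = ((n + 1 : ℕ) : ZMod (M + 1)) := by rw [← hn]; simp
      have hlt : n + 1 < M + 1 := hn ▸ ZMod.val_lt i
      have e : (i - 1).val = n := by
        rw [hin, Nat.cast_succ, add_sub_cancel_right, ZMod.val_cast_of_lt (by lia)]
      simp only [e, hn]
      have := h2 n (by lia)
      simp only [hd', dis, ← hin] at this
      have e' : (n : ZMod (M + 1)) = i - 1 := by rw [hin]; simp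
      rw [e'] at this
      linarith

end BPO

namespace BPO

/-- Adding a Boolean variable of mean `t` whose product with a `0/1`-valued function `F` has
mean `r'`. -/
theorem IsMean.exists_new {Ω Ω' : Type} {L : (Ω → ℝ) →ₗ[ℝ] ℝ} (hL : IsMean L)
    (F : Ω → ℝ) (hF : ∀ x, F x = 0 ∨ F x = 1) (g : Bool → Ω → Ω') {r r' t : ℝ} (hr : L F = r)
    (h0 : 0 ≤ r') (h1 : r' ≤ r) (h2 : r' ≤ t) (h3 : t - r' ≤ 1 - r) :
    ∃ L' : (Ω' → ℝ) →ₗ[ℝ] ℝ, IsMean L' ∧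
      (∀ F' : Ω' → ℝ, (∀ x, F' (g true x) = F' (g false x)) →
        L' F' = L (fun x => F' (g true x))) ∧
      (∀ F' : Ω' → ℝ, (∀ x, F' (g true x) = 1) → (∀ x, F' (g false x) = 0) → L' F' = t) ∧
      (∀ F' : Ω' → ℝ, (∀ x, F' (g true x) = F x) → (∀ x, F' (g false x) = 0) → L' F' = r') := by
  obtain ⟨k, k0, k1, hk⟩ := exists_mul_eq_of_le h0 h1
  obtain ⟨k', k0', k1', hk'⟩ := exists_mul_eq_of_le (sub_nonneg.2 h2) h3
  let κ : Ω → ℝ := fun x => k' + (k - k') * F x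
  have κ0 : ∀ x, 0 ≤ κ x ∧ κ x ≤ 1 := by
    intro x
    rcases hF x with h | h <;> simp [κ, *]
  obtain ⟨L', hL', hLL⟩ := hL.exists_kernel (fun b x => if b then κ x else 1 - κ x) g
    (by intro b x; have := κ0 x; cases b <;> simp [this]) (by intro x; simp)
  simp only [Fintype.sum_bool, if_true, Bool.false_eq_true, if_false] at hLL
  have lin : ∀ c c' : ℝ, L (fun x => c + c' * F x) = c + c' * r := by
    intro c c'
    have : (fun x => c + c' * F x) = c • (fun _ => (1 : ℝ)) + c' • F := by ext x; simp
    rw [this, map_add, map_smul, map_smul, hL.one, hr]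
    simp
  refine ⟨L', hL', fun F' h => ?_, fun F' h h' => ?_, fun F' h h' => ?_⟩
  · rw [hLL]
    congr 1
    ext x
    rw [h]
    ring
  · rw [hLL]
    simp only [h, h', mul_one, mul_zero, add_zero, κ, lin]
    linarith
  · rw [hLL]
    have : (fun x => κ x * F x) = fun x => 0 + k * F x := by
      ext x
      rcases hF x with h | h <;> simp [κ, h]
    simp only [h, h', mul_zero, add_zero, this, lin]
    linarith

/-- Writing a Boolean variable of mean `p` as a product of two Boolean variables of means `p'`
and `t`. -/
theorem IsMean.exists_split {Ω Ω' : Type} {L : (Ω → ℝ) →ₗ[ℝ] ℝ} (hL : IsMean L)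
    (Y : Ω → Bool) (g₀ g₁ g₂ : Ω → Ω') {p p' t : ℝ} (hp : L (fun x => ind (Y x)) = p)
    (h0 : p ≤ p') (h1 : p ≤ t) (h2 : p' + t - 1 ≤ p) :
    ∃ L' : (Ω' → ℝ) →ₗ[ℝ] ℝ, IsMean L' ∧
      (∀ F' : Ω' → ℝ, ∀ F : Ω → ℝ, (∀ x, F' (g₀ x) = F x) →
        (∀ x, Y x = false → F' (g₁ x) = F x ∧ F' (g₂ x) = F x) → L' F' = L F) ∧
      (∀ F' : Ω' → ℝ, (∀ x, F' (g₀ x) = 1) → (∀ x, F' (g₁ x) = 0) → (∀ x, F' (g₂ x) = 0) →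
        L' F' = t) ∧
      (∀ F' : Ω' → ℝ, (∀ x, F' (g₀ x) = ind (Y x)) → (∀ x, F' (g₁ x) = 1) →
        (∀ x, Y x = false → F' (g₂ x) = 0) → L' F' = p') := by
  obtain ⟨k, k0, k1, hk⟩ := exists_mul_eq_of_le (p := t - p + (p' - p)) (r := 1 - p)
    (by linarith) (by linarith)
  obtain ⟨k', k0', k1', hk'⟩ := exists_mul_eq_of_le (p := t - p) (r := t - p + (p' - p))
    (by linarith) (by linarith)
  have e0 : 0 ≤ k * k' := mul_nonneg k0 k0'
  have e1 : 0 ≤ k * (1 - k') := mul_nonneg k0 (by linarith)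
  have f0 : k * k' * (1 - p) = t - p := by rw [← hk', ← hk]; ring
  have f1 : k * (1 - k') * (1 - p) = p' - p := by
    linear_combination hk - f0
  let κ : Option Bool → Ω → ℝ := fun b x => if Y x then (if b = none then 1 else 0) else
    match b with
    | none => k * k'
    | some true => k * (1 - k')
    | some false => 1 - k
  obtain ⟨L', hL', hLL⟩ := hL.exists_kernel κ (fun b => match b with
    | none => g₀
    | some true => g₁
    | some false => g₂)
    (by
      intro b x
      simp only [κ]
      cases Y x <;> rcases b with _ | _ | _ <;> simp [*])
    (by
      intro x
      simp only [κ, Fintype.sum_option, Fintype.sum_bool]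
      cases Y x <;> simp
      ring)
  simp only [κ, Fintype.sum_option, Fintype.sum_bool] at hLL
  have lin : ∀ c c' : ℝ, L (fun x => c + c' * ind (Y x)) = c + c' * p := by
    intro c c'
    have : (fun x => c + c' * ind (Y x)) = c • (fun _ => (1 : ℝ)) + c' • fun x => ind (Y x) := by
      ext x; simp
    rw [this, map_add, map_smul, map_smul, hL.one, hp]
    simp
  refine ⟨L', hL', fun F' F h h' => ?_, fun F' a0 a1 a2 => ?_, fun F' a0 a1 a2 => ?_⟩
  · rw [hLL]
    congr 1
    ext x
    cases hY : Y x
    · simp only [h, h' x hY, Bool.false_eq_true, if_false]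
      ring
    · simp [h]
  · rw [hLL, ← show k * k' + (1 - k * k') * p = t by linarith, ← lin]
    congr 1
    ext x
    cases hY : Y x <;> simp [a0, a1, a2]
  · rw [hLL, ← show k * (1 - k') + (1 - k * (1 - k')) * p = p' by linarith, ← lin]
    congr 1
    ext x
    cases hY : Y x <;> simp [a0, a1, a2, hY]

theorem ind_eq_zero_or_one (b : Bool) : ind b = 0 ∨ ind b = 1 := by cases b <;> simp

theorem prod_eq_zero_or_one {V : Type} (S : Finset V) {f : V → ℝ}
    (hf : ∀ v ∈ S, f v = 0 ∨ f v = 1) : ∏ v ∈ S, f v = 0 ∨ ∏ v ∈ S, f v = 1 := by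
  by_cases hc : ∃ v ∈ S, f v = 0
  · obtain ⟨v, hv, h0⟩ := hc
    exact Or.inl (Finset.prod_eq_zero hv h0)
  · push Not at hc
    exact Or.inr (Finset.prod_eq_one fun v hv => (hf v hv).resolve_left (hc v hv))

section Lift

variable {V : Type} [DecidableEq V] {m : ℕ}

/-- Product of the two junction variables of edge `i` and of its node variables in `T`. -/
def edgeFun (G : ZMod m → Finset V) (T : Finset V) (i : ZMod m) (x : V ⊕ ZMod m → Bool) : ℝ :=
  ind (x (Sum.inr (i - 1))) * ind (x (Sum.inr i)) * ∏ v ∈ G i ∩ T, ind (x (Sum.inl v))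

theorem edgeFun_eq_zero_or_one (G : ZMod m → Finset V) (T : Finset V) (i : ZMod m)
    (x : V ⊕ ZMod m → Bool) : edgeFun G T i x = 0 ∨ edgeFun G T i x = 1 := by
  have h3 := prod_eq_zero_or_one (G i ∩ T) fun v _ => ind_eq_zero_or_one (x (Sum.inl v))
  unfold edgeFun
  rcases ind_eq_zero_or_one (x (Sum.inr (i - 1))) with h1 | h1 <;>
    rcases ind_eq_zero_or_one (x (Sum.inr i)) with h2 | h2 <;>
    rcases h3 with h3 | h3 <;> simp [h1, h2, h3]

theorem edgeFun_insert {G : ZMod m → Finset V} {T : Finset V} {v : V} (hv : v ∉ T) (i : ZMod m)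
    (x : V ⊕ ZMod m → Bool) :
    edgeFun G (insert v T) i x
      = (if v ∈ G i then ind (x (Sum.inl v)) else 1) * edgeFun G T i x := by
  unfold edgeFun
  split_ifs with h
  · rw [Finset.inter_insert_of_mem h, Finset.prod_insert (by simp [hv])]
    ring
  · rw [Finset.inter_insert_of_notMem h, one_mul]

theorem edgeFun_update_inl (G : ZMod m → Finset V) {T : Finset V} {v : V} (hv : v ∉ T)
    (i : ZMod m) (x : V ⊕ ZMod m → Bool) (b : Bool) :
    edgeFun G T i (Function.update x (Sum.inl v) b) = edgeFun G T i x := by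
  unfold edgeFun
  simp only [ne_eq, reduceCtorEq, not_false_eq_true, Function.update_of_ne]
  congr 1
  refine Finset.prod_congr rfl fun w hw => ?_
  rw [Function.update_of_ne]
  rintro h
  rw [Sum.inl.inj h] at hw
  exact hv (Finset.mem_inter.1 hw).2

theorem edgeFun_update_inr (G : ZMod m → Finset V) (T : Finset V) {i j : ZMod m} (h1 : i ≠ j)
    (h2 : i - 1 ≠ j) (x : V ⊕ ZMod m → Bool) (b : Bool) :
    edgeFun G T i (Function.update x (Sum.inr j) b) = edgeFun G T i x := by
  unfold edgeFun
  simp [Function.update_of_ne, h1, h2]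

/-- The nodes that edge `i` shares with edge `i + 1`. -/
def junction (G : ZMod m → Finset V) (i : ZMod m) : Finset V := G i ∩ G (i + 1)

theorem junction_sub_one (G : ZMod m → Finset V) (i : ZMod m) :
    junction G (i - 1) = G (i - 1) ∩ G i := by
  rw [junction, sub_add_cancel]

/-- The nodes that belong to edge `i` only. -/
def own (G : ZMod m → Finset V) (i : ZMod m) : Finset V := G i \ (G (i - 1) ∪ G (i + 1))

/-- A partially lifted distribution: the nodes in `T` have been realized, while `p` and `r` are
the means of the remaining junction variables and of the partial edge products. -/
structure PartialLift (G : ZMod m → Finset V) (z : V ⊕ ZMod m → ℝ) (T : Finset V)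
    (p r : ZMod m → ℝ) (L : ((V ⊕ ZMod m → Bool) → ℝ) →ₗ[ℝ] ℝ) : Prop where
  isMean : IsMean L
  node : ∀ v ∈ T, L (fun x => ind (x (Sum.inl v))) = z (Sum.inl v)
  junc : ∀ i, L (fun x => ind (x (Sum.inr i))) = p i
  le_p : ∀ i, 1 - ∑ v ∈ junction G i \ T, (1 - z (Sum.inl v)) ≤ p i
  p_le : ∀ i, ∀ v ∈ junction G i \ T, p i ≤ z (Sum.inl v)
  edge : ∀ i, L (edgeFun G T i) = r i
  le_r : ∀ i, z (Sum.inr i) ≤ r i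
  r_le : ∀ i, r i ≤ z (Sum.inr i) + ∑ v ∈ own G i \ T, (1 - z (Sum.inl v))

theorem sdiff_insert_of_notMem {S T : Finset V} {v : V} (h : v ∉ S) : S \ insert v T = S \ T := by
  ext w
  simp only [Finset.mem_sdiff, Finset.mem_insert]
  constructor
  · rintro ⟨h1, h2⟩; exact ⟨h1, fun h3 => h2 (Or.inr h3)⟩
  · rintro ⟨h1, h2⟩; exact ⟨h1, by rintro (rfl | h3) <;> contradiction⟩

theorem sum_sdiff_eq_add {S T : Finset V} {v : V} (hS : v ∈ S) (hT : v ∉ T) (f : V → ℝ) :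
    ∑ w ∈ S \ T, f w = f v + ∑ w ∈ S \ insert v T, f w := by
  have h : S \ T = insert v (S \ insert v T) := by
    ext w
    by_cases hw : w = v
    · subst hw; simp [hS, hT]
    · simp [hw]
  rw [h, Finset.sum_insert (by simp)]

variable {G : ZMod m → Finset V} {z : V ⊕ ZMod m → ℝ} {T : Finset V} {p r : ZMod m → ℝ}
  {L : ((V ⊕ ZMod m → Bool) → ℝ) →ₗ[ℝ] ℝ}

theorem PartialLift.insert_isolated (h : PartialLift G z T p r L) {v : V} (hv : v ∉ T)
    (hz : 0 ≤ z (Sum.inl v) ∧ z (Sum.inl v) ≤ 1) (hG : ∀ i, v ∉ G i) :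
    ∃ p' r' L', PartialLift G z (insert v T) p' r' L' := by
  obtain ⟨L', hL', hinv, hnew, -⟩ := h.isMean.exists_new (fun _ => 0) (by simp)
    (fun b x => Function.update x (Sum.inl v) b) (r := 0) (r' := 0) (t := z (Sum.inl v))
    (map_zero L) le_rfl le_rfl hz.1 (by linarith)
  have hS : ∀ i, v ∉ junction G i := fun i hi => hG i (Finset.mem_inter.1 hi).1
  have hR : ∀ i, v ∉ own G i := fun i hi => hG i (Finset.mem_sdiff.1 hi).1
  refine ⟨p, r, L', hL', ?_, ?_, ?_, ?_, ?_, h.le_r, ?_⟩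
  · intro w hw
    rcases Finset.mem_insert.1 hw with rfl | hw
    · exact hnew _ (by simp) (by simp)
    · have hne : w ≠ v := fun e => hv (e ▸ hw)
      rw [hinv _ (by simp [hne]), ← h.node w hw]
      simp [hne]
  · intro i
    rw [hinv _ (by simp), ← h.junc i]
    simp
  · intro i
    rw [sdiff_insert_of_notMem (hS i)]
    exact h.le_p i
  · intro i
    rw [sdiff_insert_of_notMem (hS i)]
    exact h.p_le i
  · intro i
    rw [hinv _ (by simp [edgeFun_insert hv, edgeFun_update_inl G hv, hG]), ← h.edge i]
    simp [edgeFun_insert hv, edgeFun_update_inl G hv, hG]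
  · intro i
    rw [sdiff_insert_of_notMem (hR i)]
    exact h.r_le i

theorem PartialLift.insert_own (h : PartialLift G z T p r L) {v : V} (hv : v ∉ T)
    (hz : ∀ w, z (Sum.inl w) ≤ 1) {j : ZMod m} (hz0 : 0 ≤ z (Sum.inr j))
    (hzj : z (Sum.inr j) ≤ z (Sum.inl v)) (hj : v ∈ G j) (hG : ∀ i, v ∈ G i → i = j)
    (hm : (1 : ZMod m) ≠ 0) :
    ∃ p' r' L', PartialLift G z (insert v T) p' r' L' := by
  have hvR : v ∈ own G j := by
    simp only [own, Finset.mem_sdiff, hj, Finset.mem_union, true_and]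
    rintro (h1 | h1)
    · exact hm (by simpa using hG _ h1)
    · exact hm (by simpa using hG _ h1)
  have hrj := h.r_le j
  rw [sum_sdiff_eq_add hvR hv] at hrj
  have hrz := h.le_r j
  have hrest : 0 ≤ ∑ w ∈ own G j \ insert v T, (1 - z (Sum.inl w)) :=
    Finset.sum_nonneg fun w _ => sub_nonneg.2 (hz w)
  have hr1 : r j ≤ 1 := by
    rw [← h.edge j, ← h.isMean.one]
    refine h.isMean.mono fun x => ?_
    rcases edgeFun_eq_zero_or_one G T j x with h0 | h0 <;> simp [h0]
  have hzv := hz v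
  obtain ⟨L', hL', hinv, hnew, hedge⟩ := h.isMean.exists_new (edgeFun G T j)
    (edgeFun_eq_zero_or_one G T j) (fun b x => Function.update x (Sum.inl v) b)
    (r' := max (z (Sum.inr j)) (r j + z (Sum.inl v) - 1)) (t := z (Sum.inl v)) (h.edge j)
    (le_max_of_le_left hz0) (max_le hrz (by linarith)) (max_le hzj (by linarith))
    (by linarith [le_max_right (z (Sum.inr j)) (r j + z (Sum.inl v) - 1)])
  have hS : ∀ i, v ∉ junction G i := fun i hi => by
    have h1 := hG _ (Finset.mem_inter.1 hi).1
    have h2 := hG _ (Finset.mem_inter.1 hi).2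
    exact hm (by simpa [h1] using h2)
  refine ⟨p, Function.update r j (max (z (Sum.inr j)) (r j + z (Sum.inl v) - 1)), L', hL',
    ?_, ?_, ?_, ?_, ?_, ?_, ?_⟩
  · intro w hw
    rcases Finset.mem_insert.1 hw with rfl | hw
    · exact hnew _ (by simp) (by simp)
    · have hne : w ≠ v := fun e => hv (e ▸ hw)
      rw [hinv _ (by simp [hne]), ← h.node w hw]
      simp [hne]
  · intro i
    rw [hinv _ (by simp), ← h.junc i]
    simp
  · intro i
    rw [sdiff_insert_of_notMem (hS i)]
    exact h.le_p i
  · intro i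
    rw [sdiff_insert_of_notMem (hS i)]
    exact h.p_le i
  · intro i
    by_cases hi : i = j
    · subst hi
      rw [Function.update_self]
      exact hedge _ (by simp [edgeFun_insert hv, edgeFun_update_inl G hv, hj])
        (by simp [edgeFun_insert hv, hj])
    · have hvi : v ∉ G i := fun h' => hi (hG i h')
      rw [hinv _ (by simp [edgeFun_insert hv, edgeFun_update_inl G hv, hvi]),
        Function.update_of_ne hi, ← h.edge i]
      simp [edgeFun_insert hv, edgeFun_update_inl G hv, hvi]
  · intro i
    by_cases hi : i = j
    · subst hi
      rw [Function.update_self]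
      exact le_max_left _ _
    · rw [Function.update_of_ne hi]
      exact h.le_r i
  · intro i
    by_cases hi : i = j
    · subst hi
      rw [Function.update_self]
      exact max_le (by linarith) (by linarith)
    · rw [Function.update_of_ne hi, sdiff_insert_of_notMem]
      · exact h.r_le i
      · exact fun h' => hi (hG i (Finset.mem_sdiff.1 h').1)

theorem PartialLift.insert_junction (h : PartialLift G z T p r L) {v : V} (hv : v ∉ T)
    (hz : ∀ w, z (Sum.inl w) ≤ 1) {j : ZMod m} (hG : ∀ i, v ∈ G i ↔ i = j ∨ i = j + 1)
    (hm2 : (2 : ZMod m) ≠ 0) :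
    ∃ p' r' L', PartialLift G z (insert v T) p' r' L' := by
  have hvj : v ∈ junction G j :=
    Finset.mem_inter.2 ⟨(hG j).2 (Or.inl rfl), (hG (j + 1)).2 (Or.inr rfl)⟩
  have hS : ∀ i, i ≠ j → v ∉ junction G i := fun i hi hi' => by
    have h1 := ((hG _).1 (Finset.mem_inter.1 hi').1).resolve_left hi
    rcases (hG _).1 (Finset.mem_inter.1 hi').2 with h2 | h2
    · rw [h1] at h2
      exact hm2 (by linear_combination h2)
    · exact hi (add_right_cancel h2)
  have hR : ∀ i, v ∉ own G i := fun i hi => by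
    simp only [own, Finset.mem_sdiff, Finset.mem_union, hG, not_or] at hi
    rcases hi.1 with rfl | rfl
    · exact hi.2.2.2 rfl
    · exact hi.2.1.1 (by ring)
  have hlj := h.le_p j
  rw [sum_sdiff_eq_add hvj hv] at hlj
  have hpv := h.p_le j v (by simp [hvj, hv])
  have hrest : 0 ≤ ∑ w ∈ junction G j \ insert v T, (1 - z (Sum.inl w)) :=
    Finset.sum_nonneg fun w _ => sub_nonneg.2 (hz w)
  have hzv := hz v
  set p' := max (p j) (1 - ∑ w ∈ junction G j \ insert v T, (1 - z (Sum.inl w))) with hp'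
  obtain ⟨L', hL', hinv, hnew, hjun⟩ := h.isMean.exists_split (fun x => x (Sum.inr j))
    (fun x => Function.update x (Sum.inl v) true)
    (fun x => Function.update (Function.update x (Sum.inl v) false) (Sum.inr j) true)
    (fun x => Function.update x (Sum.inl v) false)
    (p' := p') (t := z (Sum.inl v)) (h.junc j)
    (le_max_left _ _) hpv (by
      have : p' ≤ p j + 1 - z (Sum.inl v) := max_le (by linarith) (by linarith)
      linarith)
  refine ⟨Function.update p j p', r, L', hL', ?_, ?_, ?_, ?_, ?_, h.le_r, ?_⟩
  · intro w hw
    rcases Finset.mem_insert.1 hw with rfl | hw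
    · exact hnew _ (by simp) (by simp) (by simp)
    · have hne : w ≠ v := fun e => hv (e ▸ hw)
      rw [hinv _ (fun x => ind (x (Sum.inl w))) (by simp [hne]) (by simp [hne]), ← h.node w hw]
  · intro i
    by_cases hi : i = j
    · subst hi
      rw [Function.update_self]
      exact hjun _ (by simp) (by simp) (by simp +contextual)
    · rw [Function.update_of_ne hi, ← h.junc i]
      exact hinv _ _ (by simp) (by simp [hi])
  · intro i
    by_cases hi : i = j
    · subst hi
      rw [Function.update_self]
      exact le_max_right _ _
    · rw [Function.update_of_ne hi, sdiff_insert_of_notMem (hS i hi)]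
      exact h.le_p i
  · intro i w hw
    by_cases hi : i = j
    · subst hi
      rw [Function.update_self]
      have hwT : w ∈ junction G i \ T := by
        simp only [Finset.mem_sdiff, Finset.mem_insert, not_or] at hw ⊢
        exact ⟨hw.1, hw.2.2⟩
      refine max_le (h.p_le i w hwT) ?_
      have := Finset.single_le_sum (f := fun w => 1 - z (Sum.inl w))
        (fun w _ => sub_nonneg.2 (hz w)) hw
      linarith
    · rw [sdiff_insert_of_notMem (hS i hi)] at hw
      rw [Function.update_of_ne hi]
      exact h.p_le i w hw
  · intro i
    rw [← h.edge i]
    refine hinv _ _ ?_ ?_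
    · simp [edgeFun_insert hv, edgeFun_update_inl G hv]
    · intro x hx
      by_cases hi : v ∈ G i
      · have h0 : edgeFun G T i x = 0 := by
          rcases (hG i).1 hi with rfl | rfl <;> simp [edgeFun, hx]
        simp [edgeFun_insert hv, hi, edgeFun_update_inl G hv, h0]
      · have h1 : i ≠ j := fun e => hi ((hG i).2 (Or.inl e))
        have h2 : i - 1 ≠ j := fun e => hi ((hG i).2 (Or.inr (by rw [← e]; ring)))
        simp [edgeFun_insert hv, hi, edgeFun_update_inl G hv, edgeFun_update_inr G T h1 h2]
  · intro i
    rw [sdiff_insert_of_notMem (hR i)]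
    exact h.r_le i

theorem exists_partialLift [Fintype V] (h : PartialLift G z T p r L)
    (hz : ∀ x, 0 ≤ z x ∧ z x ≤ 1) (hle : ∀ i, ∀ v ∈ G i, z (Sum.inr i) ≤ z (Sum.inl v))
    (hm : (1 : ZMod m) ≠ 0) (hm2 : (2 : ZMod m) ≠ 0)
    (hG : ∀ v, (∀ i, v ∉ G i) ∨ (∃ j, ∀ i, v ∈ G i ↔ i = j) ∨
      ∃ j, ∀ i, v ∈ G i ↔ i = j ∨ i = j + 1) :
    ∃ p' r' L', PartialLift G z Finset.univ p' r' L' := by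
  suffices H : ∀ T' : Finset V, ∃ p' r' L', PartialLift G z (T ∪ T') p' r' L' by
    have := H Finset.univ
    rwa [Finset.union_eq_right.2 (Finset.subset_univ T)] at this
  intro T'
  induction T' using Finset.induction_on with
  | empty => exact ⟨p, r, L, by simpa using h⟩
  | insert v T' _ ih =>
    obtain ⟨p', r', L', h'⟩ := ih
    rw [Finset.union_insert]
    by_cases hv : v ∈ T ∪ T'
    · rw [Finset.insert_eq_of_mem hv]
      exact ⟨p', r', L', h'⟩
    rcases hG v with hi | ⟨j, hj⟩ | ⟨j, hj⟩
    · exact h'.insert_isolated hv (hz _) hi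
    · exact h'.insert_own hv (fun w => (hz _).2) (hz _).1 (hle j v ((hj j).2 rfl))
        ((hj j).2 rfl) (fun i => (hj i).1) hm
    · exact h'.insert_junction hv (fun w => (hz _).2) hj hm2

/-- A fully lifted distribution has the prescribed edge means. -/
theorem PartialLift.apply_prod [Fintype V] (h : PartialLift G z Finset.univ p r L) (i : ZMod m) :
    L (fun x => ∏ v ∈ G i, ind (x (Sum.inl v))) = z (Sum.inr i) := by
  have hS : ∀ S : Finset V, S \ Finset.univ = ∅ := fun S => by ext; simp
  have hp : ∀ i, 1 ≤ p i := fun i => by simpa only [hS, Finset.sum_empty, sub_zero] using h.le_p i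
  have hr : r i = z (Sum.inr i) :=
    le_antisymm (by simpa only [hS, Finset.sum_empty, add_zero] using h.r_le i) (h.le_r i)
  have h1 : L (edgeFun G Finset.univ i) ≤ L (fun x => ∏ v ∈ G i, ind (x (Sum.inl v))) := by
    refine h.isMean.mono fun x => ?_
    have : 0 ≤ ∏ v ∈ G i, ind (x (Sum.inl v)) :=
      Finset.prod_nonneg fun v _ => by cases x (Sum.inl v) <;> simp
    simp only [edgeFun, Finset.inter_univ]
    cases x (Sum.inr (i - 1)) <;> cases x (Sum.inr i) <;> simp [this]
  have h2 : L (fun x => ∏ v ∈ G i, ind (x (Sum.inl v))) ≤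
      L (edgeFun G Finset.univ i + (((fun _ => 1) - fun x => ind (x (Sum.inr (i - 1)))) +
        ((fun _ => 1) - fun x => ind (x (Sum.inr i))))) := by
    refine h.isMean.mono fun x => ?_
    have : ∏ v ∈ G i, ind (x (Sum.inl v)) ≤ 1 :=
      Finset.prod_le_one (fun v _ => by cases x (Sum.inl v) <;> simp)
        (fun v _ => by cases x (Sum.inl v) <;> simp)
    simp only [edgeFun, Finset.inter_univ, Pi.add_apply, Pi.sub_apply]
    cases x (Sum.inr (i - 1)) <;> cases x (Sum.inr i) <;> simp <;> linarith
  rw [map_add, map_add, map_sub, map_sub, h.isMean.one, h.junc, h.junc] at h2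
  rw [h.edge, hr] at h1 h2
  linarith [hp i, hp (i - 1)]

theorem Feas.partialLift [NeZero m] {u a q : ZMod m → ℝ}
    (h : Feas (fun i => z (Sum.inr i)) (fun i => ∑ v ∈ own G i, (1 - z (Sum.inl v)))
      (fun i => 1 - ∑ v ∈ junction G i, (1 - z (Sum.inl v))) u a q)
    (hu : ∀ i, ∀ v ∈ junction G i, u i ≤ z (Sum.inl v))
    {L : ((ZMod m → Bool) → ℝ) →ₗ[ℝ] ℝ} (hL : IsMean L)
    (ha : ∀ i, L (fun w => ind (w i)) = a i)
    (hq : ∀ i, L (fun w => ind (w (i - 1)) * ind (w i)) = q i) :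
    ∃ L', PartialLift G z ∅ a q L' := by
  obtain ⟨L', hL', hLL⟩ := hL.exists_kernel (B := Unit) (fun _ _ => 1)
    (fun _ w => Sum.elim (fun _ : V => true) w) (by simp) (by simp)
  simp only [Finset.univ_unique, Finset.sum_singleton, one_mul] at hLL
  refine ⟨L', hL', by simp, fun i => ?_, fun i => ?_, fun i v hv => ?_, fun i => ?_, h.z_le_q,
    fun i => ?_⟩
  · rw [hLL, ← ha i]
    rfl
  · simpa using h.lower i
  · exact (h.upper i).trans (hu i v (by simpa using hv))
  · rw [hLL, ← hq i]
    simp [edgeFun]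
  · simpa using h.q_le i

end Lift

/-- A distribution on node assignments with the prescribed means yields a point of the
multilinear polytope. -/
theorem mem_PML {V E : Type} [Fintype V] [DecidableEq V] {G : E → Finset V} {z : V ⊕ E → ℝ}
    {Ω : Type} {L : (Ω → ℝ) →ₗ[ℝ] ℝ} (hL : IsMean L) (f : Ω → V → Bool)
    (hv : ∀ v, L (fun x => ind (f x v)) = z (Sum.inl v))
    (he : ∀ e, L (fun x => ∏ v ∈ G e, ind (f x v)) = z (Sum.inr e)) : z ∈ PML G := by
  let pt : (V → Bool) → V ⊕ E → ℝ := fun y =>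
    Sum.elim (fun v => ind (y v)) fun e => ∏ v ∈ G e, ind (y v)
  let δ : (V → Bool) → Ω → ℝ := fun y x => if f x = y then 1 else 0
  have key : ∀ F : (V → Bool) → ℝ, L (fun x => F (f x)) = ∑ y, L (δ y) * F y := by
    intro F
    have : (fun x => F (f x)) = ∑ y, F y • δ y := by
      ext x
      simp [δ, Finset.sum_apply]
    rw [this, map_sum]
    simp [mul_comm]
  have hz : z = ∑ y, L (δ y) • pt y := by
    ext s
    rw [Finset.sum_apply]
    rcases s with v | e
    · rw [← hv, key fun y => ind (y v)]
      rfl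
    · rw [← he, key fun y => ∏ v ∈ G e, ind (y v)]
      rfl
  have hpt : ∀ y, pt y ∈ PML G := by
    refine fun y => subset_convexHull ℝ _ ⟨?_, fun e => rfl⟩
    rintro (v | e)
    · exact ind_eq_zero_or_one _
    · exact prod_eq_zero_or_one _ fun v _ => ind_eq_zero_or_one _
  rw [hz]
  refine (convex_convexHull ℝ _).sum_mem (fun y _ => hL.nonneg _ fun x => ?_) ?_ fun y _ => hpt y
  · simp only [δ]
    split_ifs <;> simp
  · have := key fun _ => 1
    simpa [hL.one] using this.symm

end BPO

namespace BPO

section Cycle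

variable {V : Type} [DecidableEq V] {m : ℕ} [NeZero m] {G : ZMod m → Finset V}

theorem IsCycleFam.one_ne_zero (hG : IsCycleFam m G) : (1 : ZMod m) ≠ 0 := by
  have := hG.1
  have : Fact (1 < m) := ⟨by omega⟩
  exact _root_.one_ne_zero

theorem IsCycleFam.two_ne_zero (hG : IsCycleFam m G) : (2 : ZMod m) ≠ 0 := by
  intro h
  have h2 : ((2 : ℕ) : ZMod m) = 0 := by exact_mod_cast h
  rw [ZMod.natCast_eq_zero_iff] at h2
  have := Nat.le_of_dvd two_pos h2
  have := hG.1
  omega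

theorem IsCycleFam.eq_of_mem (hG : IsCycleFam m G) {v : V} {i j : ZMod m} (hi : v ∈ G i)
    (hj : v ∈ G j) : j = i - 1 ∨ j = i ∨ j = i + 1 := by
  by_contra! hc
  have h : v ∈ G i ∩ G j := Finset.mem_inter.2 ⟨hi, hj⟩
  rw [hG.2.2.2.1 i j hc.1 hc.2.1 hc.2.2] at h
  exact Finset.notMem_empty v h

theorem IsCycleFam.triple (hG : IsCycleFam m G) {v : V} {i : ZMod m} (h1 : v ∈ G (i - 1))
    (h2 : v ∈ G i) (h3 : v ∈ G (i + 1)) : False := by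
  by_cases hm : m = 3
  · have h := hG.2.2.2.2 hm
    have key : ∀ i j : ZMod 3, j = i - 1 ∨ j = i ∨ j = i + 1 := by decide
    subst hm
    have hall : ∀ j, v ∈ G j := fun j => by
      rcases key i j with rfl | rfl | rfl <;> assumption
    have hv : v ∈ G 0 ∩ G 1 ∩ G 2 := by simp [hall]
    rw [h] at hv
    exact Finset.notMem_empty v hv
  · rcases hG.eq_of_mem h1 h3 with h | h | h
    · have h3 : ((3 : ℕ) : ZMod m) = 0 := by
        push_cast
        linear_combination h
      rw [ZMod.natCast_eq_zero_iff] at h3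
      have := Nat.le_of_dvd three_pos h3
      have := hG.1
      omega
    · exact hG.two_ne_zero (by linear_combination h)
    · exact hG.one_ne_zero (by linear_combination h)

theorem IsCycleFam.mem_iff_of_junction (hG : IsCycleFam m G) {v : V} {i : ZMod m}
    (h1 : v ∈ G i) (h2 : v ∈ G (i + 1)) (j : ZMod m) : v ∈ G j ↔ j = i ∨ j = i + 1 := by
  refine ⟨fun hj => ?_, by rintro (rfl | rfl) <;> assumption⟩
  rcases hG.eq_of_mem h1 hj with h | h | h
  · exact (hG.triple (h ▸ hj) h1 h2).elim
  · exact Or.inl h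
  · exact Or.inr h

theorem IsCycleFam.cases (hG : IsCycleFam m G) (v : V) : (∀ i, v ∉ G i) ∨
    (∃ j, ∀ i, v ∈ G i ↔ i = j) ∨ ∃ j, ∀ i, v ∈ G i ↔ i = j ∨ i = j + 1 := by
  by_cases h1 : ∃ j, v ∈ G j ∧ v ∈ G (j + 1)
  · obtain ⟨j, hj, hj'⟩ := h1
    exact Or.inr (Or.inr ⟨j, hG.mem_iff_of_junction hj hj'⟩)
  push Not at h1
  by_cases h2 : ∃ j, v ∈ G j
  · obtain ⟨j, hj⟩ := h2
    refine Or.inr (Or.inl ⟨j, fun i => ⟨fun hi => ?_, by rintro rfl; exact hj⟩⟩)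
    rcases hG.eq_of_mem hj hi with h | h | h
    · exact (h1 i hi (by rwa [h, sub_add_cancel])).elim
    · exact h
    · exact (h1 j hj (h ▸ hi)).elim
  · push Not at h2
    exact Or.inl h2

theorem IsCycleFam.sum_sdiff_left (hG : IsCycleFam m G) (i : ZMod m) (f : V → ℝ) :
    ∑ v ∈ G i \ G (i - 1), f v = ∑ v ∈ junction G i, f v + ∑ v ∈ own G i, f v := by
  rw [← Finset.sum_union]
  · congr 1
    ext v
    have := @IsCycleFam.triple V _ m _ G hG v i
    simp only [junction, own, Finset.mem_sdiff, Finset.mem_union, Finset.mem_inter]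
    tauto
  · rw [Finset.disjoint_left]
    simp only [junction, own, Finset.mem_sdiff, Finset.mem_union, Finset.mem_inter]
    tauto

theorem IsCycleFam.sum_sdiff_right (hG : IsCycleFam m G) (i : ZMod m) (f : V → ℝ) :
    ∑ v ∈ G i \ G (i + 1), f v = ∑ v ∈ junction G (i - 1), f v + ∑ v ∈ own G i, f v := by
  rw [← Finset.sum_union]
  · congr 1
    ext v
    have := @IsCycleFam.triple V _ m _ G hG v i
    simp only [junction_sub_one, own, Finset.mem_sdiff, Finset.mem_union, Finset.mem_inter]
    tauto
  · rw [Finset.disjoint_left]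
    simp only [junction_sub_one, own, Finset.mem_sdiff, Finset.mem_union, Finset.mem_inter]
    tauto

theorem IsCycleFam.sum_edge (hG : IsCycleFam m G) (i : ZMod m) (f : V → ℝ) :
    ∑ v ∈ G i, f v
      = ∑ v ∈ junction G (i - 1), f v + ∑ v ∈ junction G i, f v + ∑ v ∈ own G i, f v := by
  rw [add_assoc, ← hG.sum_sdiff_left, junction_sub_one, Finset.inter_comm,
    Finset.sum_inter_add_sum_sdiff]

theorem IsCycleFam.exists_adm (hG : IsCycleFam m G) {z : V ⊕ ZMod m → ℝ} (hz : memFR G z)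
    {u : ZMod m → ℝ} (hu : ∀ i, ∃ v ∈ junction G i, u i = z (Sum.inl v)) :
    ∃ a, Adm (fun i => z (Sum.inr i)) (fun i => ∑ v ∈ own G i, (1 - z (Sum.inl v)))
      (fun i => 1 - ∑ v ∈ junction G i, (1 - z (Sum.inl v))) u a := by
  obtain ⟨⟨h01, hle, hSR⟩, hF1, hF2⟩ := hz
  let l : ZMod m → ℝ := fun i => 1 - ∑ v ∈ junction G i, (1 - z (Sum.inl v))
  have hpos : ∀ S : Finset V, 0 ≤ ∑ v ∈ S, (1 - z (Sum.inl v)) := fun S =>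
    Finset.sum_nonneg fun v _ => sub_nonneg.2 (h01 _).2
  have hzz : ∀ i, z (Sum.inr i) ≤ 1 := fun i => (h01 _).2
  have hl : ∀ i, l i ≤ 1 := fun i => by linarith [hpos (junction G i)]
  have hne : ∀ i : ZMod m, i ≠ i - 1 := fun i h =>
    hG.one_ne_zero (by linear_combination h)
  have hne' : ∀ i : ZMod m, i ≠ i + 1 := fun i h =>
    hG.one_ne_zero (by linear_combination -h)
  have hne'' : ∀ i : ZMod m, i - 1 ≠ i + 1 := fun i h =>
    hG.two_ne_zero (by linear_combination -h)
  have hn : ∀ i, (G i ∩ G (i - 1)).Nonempty := fun i => by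
    have := hG.2.2.1 (i - 1)
    rwa [sub_add_cancel, Finset.inter_comm] at this
  refine ⟨fun i => max (l i) (max (z (Sum.inr i)) (z (Sum.inr (i + 1)))), fun i => le_max_left _ _,
    fun i => ?_, fun i => le_max_of_le_right (le_max_left _ _), fun i => ?_, fun i => ?_⟩
  · obtain ⟨v, hv, huv⟩ := hu i
    rw [huv]
    refine max_le ?_ (max_le ?_ ?_)
    · have := Finset.single_le_sum (f := fun w => 1 - z (Sum.inl w))
        (fun w _ => sub_nonneg.2 (h01 (Sum.inl w)).2) hv
      simp only [l]
      linarith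
    · linarith [hle i v (Finset.mem_inter.1 hv).1]
    · linarith [hle (i + 1) v (Finset.mem_inter.1 hv).2]
  · simp only [sub_add_cancel]
    exact le_max_of_le_right (le_max_right _ _)
  · have e0 := hSR i
    have e1 := hF1 i (i - 1) (hne i) (hn i)
    have e2 := hF1 i (i + 1) (hne' i) (hG.2.2.1 i)
    have e3 := hF2 i (i - 1) (i + 1) (hne i) (hne' i) (hne'' i) (hn i) (hG.2.2.1 i) (by
      rw [Finset.eq_empty_iff_forall_notMem]
      intro v hv
      simp only [Finset.mem_inter] at hv
      exact hG.triple hv.1.2 hv.1.1 hv.2)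
    rw [hG.sum_edge] at e0
    rw [hG.sum_sdiff_left] at e1
    rw [hG.sum_sdiff_right] at e2
    change _ + ∑ v ∈ own G i, _ ≥ 0 at e3
    have hρ := hpos (own G i)
    have := hzz i
    have := hzz (i - 1)
    have := hzz (i + 1)
    have := hl i
    have := hl (i - 1)
    simp only [sub_add_cancel, max_add, add_max, max_le_iff]
    simp only [l] at *
    refine ⟨⟨?_, ?_, ?_⟩, ⟨?_, ?_, ?_⟩, ?_, ?_, ?_⟩ <;> linarith

end Cycle

end BPO

namespace BPO

section Length

variable {V E : Type}

/-- Functions that respect affine combinations of two points. -/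
def IsAff {X : Type} (f : (X → ℝ) → ℝ) : Prop :=
  ∀ (x y : X → ℝ) (α β : ℝ), α + β = 1 → f (α • x + β • y) = α * f x + β * f y

section IsAff

variable {X : Type} {f g : (X → ℝ) → ℝ}

theorem IsAff.const (c : ℝ) : IsAff fun _ : X → ℝ => c := fun _ _ _ _ h => by
  rw [← add_mul, h, one_mul]

theorem IsAff.coord (x : X) : IsAff fun z => z x := fun _ _ _ _ _ => rfl

theorem IsAff.add (hf : IsAff f) (hg : IsAff g) : IsAff fun z => f z + g z :=
  fun x y α β h => by
    simp only [hf x y α β h, hg x y α β h]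
    ring

theorem IsAff.sub (hf : IsAff f) (hg : IsAff g) : IsAff fun z => f z - g z :=
  fun x y α β h => by
    simp only [hf x y α β h, hg x y α β h]
    ring

theorem IsAff.const_mul (c : ℝ) (hf : IsAff f) : IsAff fun z => c * f z :=
  fun x y α β h => by
    simp only [hf x y α β h]
    ring

theorem IsAff.sum {ι : Type} (S : Finset ι) {F : ι → (X → ℝ) → ℝ} (hF : ∀ i, IsAff (F i)) :
    IsAff fun z => ∑ i ∈ S, F i z := fun x y α β h => by
  simp only [hF _ x y α β h, Finset.sum_add_distrib, Finset.mul_sum]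

theorem IsAff.ge {c : ℝ} (hf : IsAff f) {x y : X → ℝ} {α β : ℝ} (hα : 0 ≤ α) (hβ : 0 ≤ β)
    (h : α + β = 1) (hx : f x ≥ c) (hy : f y ≥ c) : f (α • x + β • y) ≥ c := by
  rw [hf x y α β h]
  have e : α * c + β * c = c := by rw [← add_mul, h, one_mul]
  linarith [mul_le_mul_of_nonneg_left hx hα, mul_le_mul_of_nonneg_left hy hβ]

theorem IsAff.sum_one_sub {ι : Type} (S : Finset ι) (x : ι → X) :
    IsAff fun z : X → ℝ => ∑ i ∈ S, (1 - z (x i)) :=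
  .sum S fun i => .sub (.const 1) (.coord (x i))

theorem IsAff.sum_two_sub {ι : Type} (S : Finset ι) (x : ι → X) :
    IsAff fun z : X → ℝ => ∑ i ∈ S, (2 - 2 * z (x i)) :=
  .sum S fun i => .sub (.const 2) (.const_mul 2 (.coord (x i)))

end IsAff

theorem isAff_sInc (e : E) (v : V) : IsAff (sInc (V := V) e v) :=
  .sub (.coord _) (.coord _)

/-- Vertices of the multilinear polytope. -/
structure IsVertex (G : E → Finset V) (z : V ⊕ E → ℝ) : Prop where
  zero_or_one : ∀ x, z x = 0 ∨ z x = 1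
  edge : ∀ e, z (Sum.inr e) = ∏ v ∈ G e, z (Sum.inl v)

section Vertex

variable {G : E → Finset V} {z : V ⊕ E → ℝ}

theorem IsVertex.mem (hz : IsVertex G z) (x : V ⊕ E) : 0 ≤ z x ∧ z x ≤ 1 := by
  rcases hz.zero_or_one x with h | h <;> simp [h]

theorem IsVertex.node_eq_one (hz : IsVertex G z) {S : Finset V}
    (h : ∏ v ∈ S, z (Sum.inl v) = 1) : ∀ v ∈ S, z (Sum.inl v) = 1 := by
  intro v hv
  refine (hz.zero_or_one _).resolve_left fun h0 => ?_
  rw [Finset.prod_eq_zero hv h0] at h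
  exact zero_ne_one h

theorem IsVertex.edge_le (hz : IsVertex G z) {e : E} {v : V} (hv : v ∈ G e) :
    z (Sum.inr e) ≤ z (Sum.inl v) := by
  rcases hz.zero_or_one (Sum.inr e) with h | h
  · rw [h]; exact (hz.mem _).1
  · rw [h, hz.node_eq_one (hz.edge e ▸ h) v hv]

theorem IsVertex.sum_nonneg (hz : IsVertex G z) (S : Finset V) :
    0 ≤ ∑ v ∈ S, (1 - z (Sum.inl v)) :=
  Finset.sum_nonneg fun _ _ => sub_nonneg.2 (hz.mem _).2

theorem IsVertex.one_sub_prod_le (hz : IsVertex G z) (S : Finset V) :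
    1 - ∏ v ∈ S, z (Sum.inl v) ≤ ∑ v ∈ S, (1 - z (Sum.inl v)) := by
  by_cases hc : ∃ v ∈ S, z (Sum.inl v) = 0
  · obtain ⟨v, hv, h0⟩ := hc
    have := Finset.single_le_sum (f := fun w => 1 - z (Sum.inl w))
      (fun w _ => sub_nonneg.2 (hz.mem (Sum.inl w)).2) hv
    rw [Finset.prod_eq_zero hv h0]
    linarith
  · push Not at hc
    rw [Finset.prod_eq_one fun v hv => (hz.zero_or_one _).resolve_left (hc v hv), sub_self]
    exact hz.sum_nonneg S

end Vertex

variable [DecidableEq V]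

/-- The contribution of position `i` to the length function. -/
def term (G : E → Finset V) {k : ℕ} (ve : ZMod k → V) (ed : ZMod k → E) (sg : ZMod k → Bool)
    (z : V ⊕ E → ℝ) (i : ZMod k) : ℝ :=
  match sg (i - 1), sg i, sg (i + 1) with
  | true, true, true => sInc (ed i) (ve i) z + sInc (ed i) (ve (i + 1)) z
  | false, false, false =>
    sOdd G (ed i) (G (ed i) ∩ G (ed (i - 1))) (G (ed i) ∩ G (ed (i + 1))) z
  | true, true, false => sInc (ed i) (ve i) z
  | false, false, true => sOne G (ed i) (G (ed i) ∩ G (ed (i - 1))) (ed (i + 1)) z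
  | false, true, true => sInc (ed i) (ve (i + 1)) z
  | true, false, false => sOne G (ed i) (G (ed i) ∩ G (ed (i + 1))) (ed (i - 1)) z
  | true, false, true => sTwo G (ed i) (ed (i - 1)) (ed (i + 1)) z
  | false, true, false => 0

theorem lenFun_eq_sum_term (G : E → Finset V) (k : ℕ) [NeZero k] (ve : ZMod k → V)
    (ed : ZMod k → E) (sg : ZMod k → Bool) (z : V ⊕ E → ℝ) :
    lenFun G k ve ed sg z = ∑ i, term G ve ed sg z i := by
  unfold lenFun
  simp only [Finset.sum_filter, ← Finset.sum_add_distrib]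
  refine Finset.sum_congr rfl fun i _ => ?_
  unfold term
  cases sg (i - 1) <;> cases sg i <;> cases sg (i + 1) <;> simp

theorem isAff_sOdd (G : E → Finset V) (e : E) (U W : Finset V) : IsAff (sOdd G e U W) :=
  .add (.add (.add (.sub (.const_mul 2 (.coord _)) (.const 1)) (.sum_one_sub _ _))
    (.sum_one_sub _ _)) (.sum_two_sub _ _)

theorem isAff_sOne (G : E → Finset V) (e : E) (U : Finset V) (f : E) : IsAff (sOne G e U f) :=
  .add (.add (.add (.sub (.const_mul 2 (.coord _)) (.const 1)) (.sum_one_sub _ _))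
    (.sub (.const 1) (.coord _))) (.sum_two_sub _ _)

theorem isAff_sTwo (G : E → Finset V) (e f g : E) : IsAff (sTwo G e f g) :=
  .add (.add (.add (.sub (.const_mul 2 (.coord _)) (.const 1)) (.sub (.const 1) (.coord _)))
    (.sub (.const 1) (.coord _))) (.sum_two_sub _ _)

theorem isAff_term (G : E → Finset V) {k : ℕ} (ve : ZMod k → V) (ed : ZMod k → E)
    (sg : ZMod k → Bool) (i : ZMod k) : IsAff fun z => term G ve ed sg z i := by
  unfold term
  cases sg (i - 1) <;> cases sg i <;> cases sg (i + 1)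
  · exact isAff_sOdd _ _ _ _
  · exact isAff_sOne _ _ _ _
  · exact .const 0
  · exact isAff_sInc _ _
  · exact isAff_sOne _ _ _ _
  · exact isAff_sTwo _ _ _ _
  · exact isAff_sInc _ _
  · exact .add (isAff_sInc _ _) (isAff_sInc _ _)

theorem convex_memFR (G : E → Finset V) : Convex ℝ {z | memFR G z} := by
  rintro x ⟨⟨x1, x2, x3⟩, x4, x5⟩ y ⟨⟨y1, y2, y3⟩, y4, y5⟩ α β hα hβ h
  refine ⟨⟨fun s => ⟨?_, ?_⟩, fun e v hv => ?_, fun e => ?_⟩, fun f e h1 h2 => ?_,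
    fun f e₁ e₂ h1 h2 h3 h4 h5 h6 => ?_⟩
  · exact (IsAff.coord s).ge hα hβ h (x1 s).1 (y1 s).1
  · have := (IsAff.sub (.const 1) (.coord s)).ge (c := 0) hα hβ h
      (by linarith [(x1 s).2]) (by linarith [(y1 s).2])
    linarith
  · exact (IsAff.sub (.coord _) (.coord _)).ge hα hβ h (x2 e v hv) (y2 e v hv)
  · exact (IsAff.add (.sub (.coord _) (.const 1)) (.sum_one_sub _ _)).ge hα hβ h (x3 e) (y3 e)
  · exact (IsAff.add (.add (.sub (.coord _) (.const 1)) (.sub (.const 1) (.coord _)))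
      (.sum_one_sub _ _)).ge hα hβ h (x4 f e h1 h2) (y4 f e h1 h2)
  · exact (IsAff.add (.add (.add (.sub (.coord _) (.const 1)) (.sub (.const 1) (.coord _)))
      (.sub (.const 1) (.coord _))) (.sum_one_sub _ _)).ge hα hβ h
      (x5 f e₁ e₂ h1 h2 h3 h4 h5 h6) (y5 f e₁ e₂ h1 h2 h3 h4 h5 h6)

theorem convex_lenFun (G : E → Finset V) (k : ℕ) [NeZero k] (ve : ZMod k → V)
    (ed : ZMod k → E) (sg : ZMod k → Bool) : Convex ℝ {z | lenFun G k ve ed sg z ≥ 1} := by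
  intro x hx y hy α β hα hβ h
  simp only [Set.mem_ofPred_eq, lenFun_eq_sum_term] at hx hy ⊢
  exact (IsAff.sum _ fun i => isAff_term G ve ed sg i).ge hα hβ h hx hy

variable {G : E → Finset V} {z : V ⊕ E → ℝ}

/-- Either the edge variable is one, or some node outside `S` is zero. -/
theorem IsVertex.one_le_of_forall (hz : IsVertex G z) {e : E} {S : Finset V}
    (hS : ∀ v ∈ S, z (Sum.inl v) = 1) :
    1 ≤ z (Sum.inr e) + ∑ v ∈ G e \ S, (1 - z (Sum.inl v)) := by
  have h := hz.one_sub_prod_le (G e \ S)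
  have : z (Sum.inr e) = ∏ v ∈ G e \ S, z (Sum.inl v) := by
    rw [hz.edge]
    refine (Finset.prod_subset Finset.sdiff_subset fun v hv hv' => hS v ?_).symm
    by_contra hc
    exact hv' (Finset.mem_sdiff.2 ⟨hv, hc⟩)
  linarith

theorem IsVertex.memFR (hz : IsVertex G z) : memFR G z := by
  refine ⟨⟨hz.mem, fun e v hv => ?_, fun e => ?_⟩, fun f e _ _ => ?_, fun f e₁ e₂ _ _ _ _ _ _ => ?_⟩
  · linarith [hz.edge_le hv]
  · have := hz.one_sub_prod_le (G e)
    rw [← hz.edge] at this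
    linarith
  · have h1 := hz.sum_nonneg (G f \ G e)
    have h2 := (hz.mem (Sum.inr f)).1
    rcases hz.zero_or_one (Sum.inr e) with h | h
    · linarith
    · have := hz.one_le_of_forall (e := f) (hz.node_eq_one (hz.edge e ▸ h))
      linarith
  · have h1 := hz.sum_nonneg (G f \ (G e₁ ∪ G e₂))
    have h2 := (hz.mem (Sum.inr f)).1
    have h3 := (hz.mem (Sum.inr e₁)).2
    have h4 := (hz.mem (Sum.inr e₂)).2
    rcases hz.zero_or_one (Sum.inr e₁) with h | h
    · linarith
    rcases hz.zero_or_one (Sum.inr e₂) with h' | h'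
    · linarith
    have := hz.one_le_of_forall (e := f) (S := G e₁ ∪ G e₂) fun v hv =>
      (Finset.mem_union.1 hv).elim (hz.node_eq_one (hz.edge e₁ ▸ h) v)
        (hz.node_eq_one (hz.edge e₂ ▸ h') v)
    linarith

/-- Triangle bound for an edge traversed with negative sign. -/
theorem IsVertex.abs_add_sub_one_le (hz : IsVertex G z) (e : E) {S T : Finset V} {P Q A B : ℝ}
    (hP : P = ∏ v ∈ S, z (Sum.inl v)) (hQ : Q = ∏ v ∈ T, z (Sum.inl v))
    (hA : 1 - P ≤ A) (hB : 1 - Q ≤ B) :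
    |P + Q - 1| ≤ 2 * z (Sum.inr e) - 1 + A + B
      + ∑ v ∈ G e \ (S ∪ T), (2 - 2 * z (Sum.inl v)) := by
  have h1 := hz.sum_nonneg (G e \ (S ∪ T))
  have h2 := (hz.mem (Sum.inr e)).1
  have h3 : ∑ v ∈ G e \ (S ∪ T), (2 - 2 * z (Sum.inl v))
      = 2 * ∑ v ∈ G e \ (S ∪ T), (1 - z (Sum.inl v)) := by
    rw [Finset.mul_sum]
    exact Finset.sum_congr rfl fun v _ => by ring
  have hP' := prod_eq_zero_or_one S fun v _ => hz.zero_or_one (Sum.inl v)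
  have hQ' := prod_eq_zero_or_one T fun v _ => hz.zero_or_one (Sum.inl v)
  rw [← hP] at hP'
  rw [← hQ] at hQ'
  rw [h3, abs_le]
  rcases hP' with h | h <;> rcases hQ' with h' | h'
  · constructor <;> linarith
  · constructor <;> linarith
  · constructor <;> linarith
  · have := hz.one_le_of_forall (e := e) (S := S ∪ T) fun v hv =>
      (Finset.mem_union.1 hv).elim (hz.node_eq_one (hP ▸ h) v) (hz.node_eq_one (hQ ▸ h') v)
    constructor <;> linarith

/-- Junction labels of a signed closed walk. -/
def walkLabel (G : E → Finset V) {k : ℕ} (ve : ZMod k → V) (ed : ZMod k → E)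
    (sg : ZMod k → Bool) (z : V ⊕ E → ℝ) (i : ZMod k) : ℝ :=
  match sg i, sg (i + 1) with
  | true, true => z (Sum.inl (ve (i + 1)))
  | true, false => z (Sum.inr (ed i))
  | false, true => z (Sum.inr (ed (i + 1)))
  | false, false => ∏ v ∈ G (ed i) ∩ G (ed (i + 1)), z (Sum.inl v)

theorem IsVertex.walkLabel_eq (hz : IsVertex G z) {k : ℕ} (ve : ZMod k → V) (ed : ZMod k → E)
    (sg : ZMod k → Bool) (i : ZMod k) :
    walkLabel G ve ed sg z i = 0 ∨ walkLabel G ve ed sg z i = 1 := by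
  unfold walkLabel
  cases sg i <;> cases sg (i + 1)
  · exact prod_eq_zero_or_one _ fun v _ => hz.zero_or_one (Sum.inl v)
  all_goals exact hz.zero_or_one _

theorem IsVertex.abs_walkLabel_le (hz : IsVertex G z) {k : ℕ} {ve : ZMod k → V}
    {ed : ZMod k → E} (hw : IsClosedWalk G k ve ed) (sg : ZMod k → Bool) (i : ZMod k) :
    |(2 * walkLabel G ve ed sg z (i - 1) - 1) - sgn (sg i) * (2 * walkLabel G ve ed sg z i - 1)|
      ≤ 2 * term G ve ed sg z i := by
  have h1 := hz.edge_le (Finset.mem_inter.1 (hw.2.1 i)).2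
  have h2 := hz.edge_le (e := ed i) (v := ve (i + 1)) (by
    have := (Finset.mem_inter.1 (hw.2.1 (i + 1))).1
    rwa [add_sub_cancel_right] at this)
  have hd := fun e => hz.edge e
  have hn : ∀ P Q : ℝ, |(2 * P - 1) - -1 * (2 * Q - 1)| = 2 * |P + Q - 1| := fun P Q => by
    rw [← abs_two (α := ℝ), ← abs_mul, abs_two]
    congr 1
    ring
  have hp : ∀ P Q : ℝ, |(2 * P - 1) - 1 * (2 * Q - 1)| = 2 * |P - Q| := fun P Q => by
    rw [← abs_two (α := ℝ), ← abs_mul, abs_two]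
    congr 1
    ring
  have e1 := hz.zero_or_one (Sum.inl (ve i))
  have e2 := hz.zero_or_one (Sum.inl (ve (i + 1)))
  have hz0 := hz.zero_or_one (Sum.inr (ed i))
  unfold walkLabel term
  rw [sub_add_cancel]
  cases sg (i - 1) <;> cases sg i <;> cases sg (i + 1) <;>
    simp only [sgn, if_true, Bool.false_eq_true, if_false, hn, hp] <;>
    refine mul_le_mul_of_nonneg_left ?_ two_pos.le
  · rw [Finset.inter_comm (G (ed (i - 1)))]
    exact hz.abs_add_sub_one_le (ed i) rfl rfl (hz.one_sub_prod_le _) (hz.one_sub_prod_le _)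
  · rw [Finset.inter_comm (G (ed (i - 1)))]
    exact hz.abs_add_sub_one_le (ed i) rfl (hd _) (hz.one_sub_prod_le _) le_rfl
  · simp
  · rw [abs_le, sInc]
    constructor <;> linarith
  · rw [sOne, Finset.union_comm, add_right_comm (2 * _ - 1)]
    exact hz.abs_add_sub_one_le (ed i) (hd _) rfl le_rfl (hz.one_sub_prod_le _)
  · exact hz.abs_add_sub_one_le (ed i) (hd _) (hd _) le_rfl le_rfl
  · rw [abs_le, sInc]
    constructor <;> linarith
  · rw [abs_le, sInc, sInc]
    constructor <;> linarith

theorem IsVertex.one_le_lenFun (hz : IsVertex G z) {k : ℕ} [NeZero k] {ve : ZMod k → V}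
    {ed : ZMod k → E} (hw : IsClosedWalk G k ve ed) {sg : ZMod k → Bool} (hs : OddSig k sg) :
    lenFun G k ve ed sg z ≥ 1 := by
  rw [lenFun_eq_sum_term]
  have h := hz.abs_walkLabel_le hw sg
  refine one_le_sum_of_tight (fun i => 2 * walkLabel G ve ed sg z i - 1) _ sg
    ((oddSig_iff sg).1 hs) h 0 (le_trans ?_ (h 0))
  rcases hz.walkLabel_eq ve ed sg (0 - 1) with h1 | h1 <;>
    rcases hz.walkLabel_eq ve ed sg 0 with h2 | h2 <;> rw [h1, h2] <;> cases sg 0 <;>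
    norm_num [sgn]

end Length

section Cycle

variable {V : Type} [DecidableEq V] {m : ℕ} {G : ZMod m → Finset V}

theorem term_eq_phi {ve : ZMod m → V} (sg : ZMod m → Bool) (z : V ⊕ ZMod m → ℝ) (i : ZMod m) :
    term G ve id sg z i = phi (fun i => z (Sum.inr i))
      (fun i => ∑ v ∈ own G i, (1 - z (Sum.inl v))) sg
      (label (fun i => z (Sum.inr i)) (fun i => 1 - ∑ v ∈ junction G i, (1 - z (Sum.inl v)))
        (fun i => z (Sum.inl (ve (i + 1)))) sg) i := by
  have h2 : ∀ S : Finset V, ∑ v ∈ S, (2 - 2 * z (Sum.inl v))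
      = 2 * ∑ v ∈ S, (1 - z (Sum.inl v)) := fun S => by
    rw [Finset.mul_sum]
    exact Finset.sum_congr rfl fun v _ => by ring
  have h3 : G i \ (G i ∩ G (i - 1) ∪ G i ∩ G (i + 1)) = own G i := by
    rw [own, ← Finset.inter_union_distrib_left, Finset.sdiff_inter_self_left]
  have h4 : G i \ (G i ∩ G (i - 1) ∪ G (i + 1)) = own G i := by
    ext v; simp only [own, Finset.mem_sdiff, Finset.mem_union, Finset.mem_inter]; tauto
  have h5 : G i \ (G i ∩ G (i + 1) ∪ G (i - 1)) = own G i := by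
    ext v; simp only [own, Finset.mem_sdiff, Finset.mem_union, Finset.mem_inter]; tauto
  have h6 : G i \ (G (i - 1) ∪ G (i + 1)) = own G i := rfl
  unfold term phi label
  simp only [sub_add_cancel, junction_sub_one, Finset.inter_comm (G (i - 1))]
  cases sg (i - 1) <;> cases sg i <;> cases sg (i + 1) <;>
    simp only [sInc, sOdd, sOne, sTwo, id_eq, if_true, Bool.false_eq_true, if_false, h2, h3, h4,
      h5, h6, junction] <;> ring

variable [NeZero m]

theorem IsCycleFam.isClosedWalk (hG : IsCycleFam m G) {ve : ZMod m → V}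
    (hve : ∀ i, ve (i + 1) ∈ junction G i) : IsClosedWalk G m ve id := by
  refine ⟨hG.1, fun i => ?_, fun i => ?_⟩
  · simpa [junction] using hve (i - 1)
  · rw [Finset.eq_empty_iff_forall_notMem]
    intro v hv
    simp only [id_eq, Finset.mem_inter] at hv
    exact hG.triple hv.1.1 hv.1.2 hv.2

theorem IsCycleFam.mem_PML [Fintype V] (hG : IsCycleFam m G) {z : V ⊕ ZMod m → ℝ}
    (hz : memFR G z) (hlen : ∀ (ve : ZMod m → V) (sg : ZMod m → Bool), IsClosedWalk G m ve id →
      OddSig m sg → lenFun G m ve id sg z ≥ 1) : z ∈ PML G := by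
  have hmin : ∀ i, ∃ v ∈ junction G i, ∀ w ∈ junction G i, z (Sum.inl v) ≤ z (Sum.inl w) :=
    fun i => Finset.exists_min_image (junction G i) (fun v => z (Sum.inl v)) (hG.2.2.1 i)
  choose f hf hfmin using hmin
  have h01 := hz.1.1
  obtain ⟨a₀, h₀⟩ := hG.exists_adm hz (u := fun i => z (Sum.inl (f i)))
    fun i => ⟨f i, hf i, rfl⟩
  obtain ⟨a, q, hF, hodd⟩ := exists_feas_forall (fun i => (h01 (Sum.inr i)).1)
    (fun i => Finset.sum_nonneg fun v _ => sub_nonneg.2 (h01 (Sum.inl v)).2)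
    (fun i => (h01 (Sum.inl (f i))).2) h₀ (fun sg hsg => by
      have := hlen (fun i => f (i - 1)) sg (hG.isClosedWalk (by simpa using hf))
        ((oddSig_iff sg).2 hsg)
      rw [lenFun_eq_sum_term] at this
      simpa only [term_eq_phi, add_sub_cancel_right] using this)
  have hq0 : ∀ i, 0 ≤ q i := fun i => (h01 _).1.trans (hF.z_le_q i)
  obtain ⟨L, hL, hLa, hLq⟩ := exists_isMean_cycle (a := a) (q := q)
    (fun i => ⟨(hq0 i).trans (hF.q_le_right i), (hF.upper i).trans (h01 _).2⟩)
    (fun i => by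
      have h1 := hq0 i
      have h2 := hF.q_le_left i
      have h3 := hF.q_le_right i
      have h4 := hF.le_q i
      constructor <;> unfold dis <;> linarith) hodd
  obtain ⟨L₀, hL₀⟩ := hF.partialLift hfmin hL hLa hLq
  obtain ⟨p, r, L', hL'⟩ := exists_partialLift hL₀ h01
    (fun i v hv => by linarith [hz.1.2.1 i v hv]) hG.one_ne_zero hG.two_ne_zero hG.cases
  exact BPO.mem_PML hL'.isMean (fun x v => x (Sum.inl v)) (fun v => hL'.node v (Finset.mem_univ v))
    hL'.apply_prod

end Cycle

end BPO

/-- for a cycle hypergraph, the multilinear polytope is exactly the set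
of points of `P_FR(G)` satisfying all simple odd β-cycle inequalities. -/
theorem PML_eq_of_cycle_hypergraph {V : Type} [instV : DecidableEq V] [Fintype V]
    (m : ℕ) [NeZero m] (G : ZMod m → Finset V) (hG : BPO.IsCycleFam m G) :
    BPO.PML G = { z : V ⊕ ZMod m → ℝ | BPO.memFR G z ∧
      ∀ (k : ℕ) (h : NeZero k) (ve : ZMod k → V) (ed : ZMod k → ZMod m)
        (sg : ZMod k → Bool), BPO.IsClosedWalk G k ve ed → @BPO.OddSig k h sg →
        @BPO.lenFun V (ZMod m) instV G k h ve ed sg z ≥ 1 } := by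
  refine Set.Subset.antisymm (convexHull_min ?_ ?_) ?_
  · rintro z ⟨h1, h2⟩
    have hz : BPO.IsVertex G z := ⟨h1, h2⟩
    exact ⟨hz.memFR, fun k h ve ed sg hw hs => hz.one_le_lenFun hw hs⟩
  · intro x hx y hy α β hα hβ h
    exact ⟨BPO.convex_memFR G hx.1 hy.1 hα hβ h, fun k _ ve ed sg hw hs =>
      BPO.convex_lenFun G k ve ed sg (hx.2 k _ ve ed sg hw hs) (hy.2 k _ ve ed sg hw hs) hα hβ h⟩
  · rintro z ⟨hz, hlen⟩
    exact hG.mem_PML hz fun ve sg hw hs => hlen m _ ve id sg hw hs
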